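/- arXiv:1903.07921 — 3 statements merged into one kernel-verified Lean document; each statement's English description precedes it below -/
import Mathlib

section
/- Let B ⊆ A be a Frobenius extension of finite-dimensional algebras over a field k. If B is a Morita algebra, then A is a Morita algebra. -/
/-!
Statement 12: Let `B ⊆ A` be a Frobenius extension of finite-dimensional algebras over a
field `k`.  If `B` is a Morita algebra (in the sense of Kerner–Yamagata), then so is `A`.
-/

universe u
section FrobeniusRingHom

variable {Γ Λ : Type u} [Ring Γ] [Ring Λ]

/-- A ring homomorphism `ι : Γ → Λ` is a Frobenius extension if `Λ`, regarded as a
`Γ`-bimodule via `ι`, is finitely generated projective as a left `Γ`-module and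
`Λ ≅ Hom_Γ(Λ, Γ)` as `Λ`-`Γ`-bimodules.  Here the left `Λ`-action on `Hom_Γ(Λ, Γ)` is
`(l • f) x = f (x * l)` and the right `Γ`-action is `(f • γ) x = f x * γ`, so the two
compatibilities below say exactly that the additive isomorphism `e` is an isomorphism of
`Λ`-`Γ`-bimodules. -/
def IsFrobeniusRingHom (ι : Γ →+* Λ) : Prop :=
  letI : Module Γ Λ := Module.compHom Λ ι
  Module.Finite Γ Λ ∧ Module.Projective Γ Λ ∧
  ∃ e : Λ ≃+ (Λ →ₗ[Γ] Γ),
    (∀ (l x y : Λ), e (l * x) y = e x (y * l)) ∧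
    (∀ (γ : Γ) (x y : Λ), e (x * ι γ) y = e x y * γ)

/-- `ι : Γ → Λ` is a split monomorphism of left `Γ`-modules, where `Λ` is a left
`Γ`-module via `ι`. -/
def IsLeftSplitRingHom (ι : Γ →+* Λ) : Prop :=
  ∃ π : Λ →+ Γ, (∀ (γ : Γ) (x : Λ), π (ι γ * x) = γ * π x) ∧ ∀ γ : Γ, π (ι γ) = γ

/-- `ι : Γ → Λ` is a split monomorphism of right `Γ`-modules, where `Λ` is a right
`Γ`-module via `ι`. -/
def IsRightSplitRingHom (ι : Γ →+* Λ) : Prop :=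
  ∃ π : Λ →+ Γ, (∀ (γ : Γ) (x : Λ), π (x * ι γ) = π x * γ) ∧ ∀ γ : Γ, π (ι γ) = γ

end FrobeniusRingHom

/-- A finite-dimensional `k`-algebra `A` is a Morita algebra if `A ≅ End_Λ(X)` for a
self-injective finite-dimensional `k`-algebra `Λ` and a finitely generated generator
`X` of `Λ`-mod (i.e. `Λ` is a direct summand of a finite direct sum of copies of `X`). -/
def IsMoritaAlgebra (k : Type u) [Field k] (A : Type u) [Ring A] [Algebra k A] : Prop :=
  ∃ (Λ : Type u) (_ : Ring Λ) (_ : Algebra k Λ),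
    FiniteDimensional k Λ ∧ Module.Injective Λ Λ ∧
    ∃ (X : Type u) (_ : AddCommGroup X) (_ : Module Λ X),
      Module.Finite Λ X ∧
      (∃ (n : ℕ) (f : Λ →ₗ[Λ] (Fin n → X)) (g : (Fin n → X) →ₗ[Λ] Λ),
        g ∘ₗ f = LinearMap.id) ∧
      Nonempty (A ≃+* Module.End Λ X)

/-- Self-injectivity ascends along a ring homomorphism `j : Λ → R` for which
`s ↦ T (· * s)` identifies `R` with the left `Λ`-linear maps `R → Λ`. -/
theorem injective_of_frobenius_form {Λ R : Type u} [Ring Λ] [Ring R]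
    (hΛ : Module.Injective Λ Λ) (j : Λ →+* R) (T : R →+ Λ)
    (hT : ∀ l r, T (j l * r) = l * T r)
    (hex : ∀ h : R →+ Λ, (∀ l r, h (j l * r) = l * h r) → ∃ s, ∀ r, h r = T (r * s))
    (huniq : ∀ s, (∀ r, T (r * s) = 0) → s = 0) : Module.Injective R R := by
  let : Module Λ R := Module.compHom R j
  have smul_def : ∀ (l : Λ) (r : R), l • r = j l * r := fun _ _ => rfl
  have : IsScalarTower Λ R R := ⟨fun l r s => by simp [smul_def, mul_assoc]⟩
  refine Module.Baer.injective fun I g => ?_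
  let : Module Λ I := Module.compHom I j
  have smul_def' : ∀ (l : Λ) (r : I), l • r = j l • r := fun _ _ => rfl
  let i : I →ₗ[Λ] R :=
    { toFun := fun x => x
      map_add' := fun _ _ => rfl
      map_smul' := fun _ _ => rfl }
  let Tg : I →ₗ[Λ] Λ :=
    { toFun := fun x => T (g x)
      map_add' := fun _ _ => by simp
      map_smul' := fun l x => by simp [smul_def', hT] }
  obtain ⟨h, hh⟩ := hΛ.out i Subtype.val_injective Tg
  obtain ⟨s, hs⟩ := hex h.toAddMonoidHom fun l r => h.map_smul l r
  refine ⟨LinearMap.toSpanSingleton R R s, fun x hx => ?_⟩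
  refine sub_eq_zero.mp (huniq _ fun r => ?_)
  have h1 : h (r * x) = T (g (r • ⟨x, hx⟩)) := hh (r • ⟨x, hx⟩)
  have h2 : h (r * x) = T (r * x * s) := hs (r * x)
  rw [mul_sub, map_sub, sub_eq_zero, LinearMap.toSpanSingleton_apply, smul_eq_mul, ← mul_assoc,
    ← h2, h1, map_smul, smul_eq_mul]

/-- A Frobenius homomorphism `E : A → Γ` for a ring homomorphism `ι : Γ → A`, together with a
pair of dual bases. -/
structure FrobeniusSystem {Γ A : Type u} [Ring Γ] [Ring A] (ι : Γ →+* A) where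
  /-- The number of elements of the dual bases. -/
  n : ℕ
  /-- The Frobenius homomorphism. -/
  E : A →+ Γ
  /-- The left dual basis. -/
  x : Fin n → A
  /-- The right dual basis. -/
  y : Fin n → A
  E_left : ∀ γ a, E (ι γ * a) = γ * E a
  E_right : ∀ γ a, E (a * ι γ) = E a * γ
  sum_left : ∀ a, ∑ i, ι (E (a * y i)) * x i = a
  sum_right : ∀ a, ∑ i, y i * ι (E (x i * a)) = a

theorem IsFrobeniusRingHom.nonempty_frobeniusSystem {Γ A : Type u} [Ring Γ] [Ring A]
    {ι : Γ →+* A} (h : IsFrobeniusRingHom ι) : Nonempty (FrobeniusSystem ι) := by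
  let : Module Γ A := Module.compHom A ι
  have smul_def : ∀ (γ : Γ) (a : A), γ • a = ι γ * a := fun _ _ => rfl
  obtain ⟨_, _, e, he₁, he₂⟩ := h
  obtain ⟨n, f, g, -, -, hfg⟩ := Module.Finite.exists_comp_eq_id_of_projective Γ A
  have he : ∀ a z, e a z = e 1 (z * a) := fun a z => by rw [← he₁, mul_one]
  let x : Fin n → A := fun i => f (Pi.single i 1)
  let y : Fin n → A := fun i => e.symm (LinearMap.proj i ∘ₗ g)
  have hy : ∀ i a, e 1 (a * y i) = g a i := fun i a => by simp [y, ← he]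
  have hl : ∀ γ a, e 1 (ι γ * a) = γ * e 1 a := fun γ a => (e 1).map_smul γ a
  have hr : ∀ γ a, e 1 (a * ι γ) = e 1 a * γ := fun γ a => by
    rw [← he₂, one_mul, he (ι γ) a]
  have sum_left : ∀ a, ∑ i, ι (e 1 (a * y i)) * x i = a := fun a => by
    calc ∑ i, ι (e 1 (a * y i)) * x i = f (∑ i, g a i • Pi.single i 1) := by
          simp [hy, x, smul_def]
      _ = f (g a) := by
          congr 1
          ext j
          simp [Finset.sum_apply, Pi.single_apply]
      _ = a := LinearMap.congr_fun hfg a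
  refine ⟨⟨n, (e 1).toAddMonoidHom, x, y, hl, hr, sum_left, fun a => ?_⟩⟩
  refine e.injective (LinearMap.ext fun z => ?_)
  rw [he, he a]
  calc e 1 (z * ∑ i, y i * ι (e 1 (x i * a)))
      = ∑ i, e 1 (z * y i) * e 1 (x i * a) := by
        simp [Finset.mul_sum, ← mul_assoc, hr]
    _ = e 1 ((∑ i, ι (e 1 (z * y i)) * x i) * a) := by
        simp [Finset.sum_mul, mul_assoc, hl]
    _ = e 1 (z * a) := by rw [sum_left]

/-- Transport of a Frobenius system along an isomorphism of the base rings. -/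
def FrobeniusSystem.congr {Γ Γ' A : Type u} [Ring Γ] [Ring Γ'] [Ring A] {ι : Γ →+* A}
    (F : FrobeniusSystem ι) (σ : Γ ≃+* Γ') :
    FrobeniusSystem (ι.comp σ.symm.toRingHom) where
  n := F.n
  E := σ.toRingHom.toAddMonoidHom.comp F.E
  x := F.x
  y := F.y
  E_left γ a := by simp [F.E_left]
  E_right γ a := by simp [F.E_right]
  sum_left a := by simp [F.sum_left]
  sum_right a := by simp [F.sum_right]

/-- The coinduced module `Hom_Γ(A, X)`. -/
def coind {Γ A : Type u} [Ring Γ] [Ring A] (ι : Γ →+* A) (X : Type u) [AddCommGroup X]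
    [Module Γ X] : AddSubgroup (A → X) where
  carrier := {f | (∀ a b, f (a + b) = f a + f b) ∧ ∀ γ a, f (ι γ * a) = γ • f a}
  zero_mem' := by simp
  add_mem' := by
    rintro f g ⟨hf, hf'⟩ ⟨hg, hg'⟩
    exact ⟨fun a b => by simp [hf, hg, add_add_add_comm], fun γ a => by simp [hf', hg']⟩
  neg_mem' := by
    rintro f ⟨hf, hf'⟩
    exact ⟨fun a b => by simp [hf, add_comm], fun γ a => by simp [hf']⟩

namespace coind

section Basic

variable {Γ A X : Type u} [Ring Γ] [Ring A] {ι : Γ →+* A} [AddCommGroup X] [Module Γ X]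

theorem map_add (f : coind ι X) (a b : A) : f.1 (a + b) = f.1 a + f.1 b := f.2.1 a b

theorem map_ι_mul (f : coind ι X) (γ : Γ) (a : A) : f.1 (ι γ * a) = γ • f.1 a := f.2.2 γ a

theorem map_zero (f : coind ι X) : f.1 0 = 0 := by
  simpa using map_add f 0 0

theorem map_sum (f : coind ι X) {κ : Type*} (s : Finset κ) (a : κ → A) :
    f.1 (∑ i ∈ s, a i) = ∑ i ∈ s, f.1 (a i) :=
  _root_.map_sum (⟨⟨f.1, map_zero f⟩, map_add f⟩ : A →+ X) a s

instance : Module A (coind ι X) where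
  smul a f := ⟨fun z => f.1 (z * a), fun b c => by simp [add_mul, map_add],
    fun γ b => by simp [mul_assoc, map_ι_mul]⟩
  one_smul f := Subtype.ext (funext fun z => congrArg f.1 (mul_one z))
  mul_smul a b f := Subtype.ext (funext fun z => congrArg f.1 (mul_assoc z a b).symm)
  smul_zero a := rfl
  smul_add a f g := rfl
  add_smul a b f := Subtype.ext (funext fun z =>
    (congrArg f.1 (mul_add z a b)).trans (map_add f _ _))
  zero_smul f := Subtype.ext (funext fun z => (congrArg f.1 (mul_zero z)).trans (map_zero f))

@[simp]
theorem smul_val (a : A) (f : coind ι X) (z : A) : (a • f).1 z = f.1 (z * a) := rfl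

@[simp]
theorem add_val (f g : coind ι X) (z : A) : (f + g).1 z = f.1 z + g.1 z := rfl

@[simp]
theorem sum_val {κ : Type*} (s : Finset κ) (f : κ → coind ι X) (z : A) :
    (∑ i ∈ s, f i).1 z = ∑ i ∈ s, (f i).1 z := by
  simp

end Basic

end coind

namespace FrobeniusSystem

section Lift

variable {Γ A X M : Type u} [Ring Γ] [Ring A] {ι : Γ →+* A} (F : FrobeniusSystem ι)
  [AddCommGroup X] [Module Γ X] [AddCommGroup M] [Module A M]

/-- The unit `X → Hom_Γ(A, X)` exhibiting the coinduced module as an induced one. -/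
def unit : X →+ coind ι X where
  toFun x := ⟨fun a => F.E a • x, fun a b => by simp [add_smul],
    fun γ a => by simp [F.E_left, mul_smul]⟩
  map_zero' := Subtype.ext (funext fun a => smul_zero _)
  map_add' x z := Subtype.ext (funext fun a => smul_add _ _ _)

@[simp]
theorem unit_val (x : X) (a : A) : (F.unit x).1 a = F.E a • x := rfl

theorem unit_smul (γ : Γ) (x : X) : F.unit (γ • x) = ι γ • F.unit x :=
  Subtype.ext (funext fun a => by simp [F.E_right, mul_smul])

theorem sum_smul_unit (f : coind ι X) : ∑ i, F.y i • F.unit (f.1 (F.x i)) = f := by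
  refine Subtype.ext (funext fun a => ?_)
  conv_rhs => rw [← F.sum_left a, coind.map_sum]
  simp [coind.map_ι_mul]

/-- The `A`-linear map out of the coinduced module extending a `Γ`-linear map on `X`. -/
def lift (m : X →+ M) (hm : ∀ (γ : Γ) (x : X), m (γ • x) = ι γ • m x) :
    coind ι X →ₗ[A] M where
  toFun f := ∑ i, F.y i • m (f.1 (F.x i))
  map_add' f g := by simp [Finset.sum_add_distrib]
  map_smul' a f := by
    have h : ∀ i, m (f.1 (F.x i * a)) =
        ∑ l, ι (F.E (F.x i * (a * F.y l))) • m (f.1 (F.x l)) := fun i => by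
      conv_lhs => rw [← F.sum_left (F.x i * a), coind.map_sum]
      simp [coind.map_ι_mul, hm, mul_assoc]
    simp only [coind.smul_val, h, Finset.smul_sum, RingHom.id_apply]
    rw [Finset.sum_comm]
    refine Finset.sum_congr rfl fun l _ => ?_
    conv_rhs => rw [smul_smul, ← F.sum_right (a * F.y l), Finset.sum_smul]
    simp [mul_smul]

theorem lift_unit (m : X →+ M) (hm : ∀ (γ : Γ) (x : X), m (γ • x) = ι γ • m x) (x : X) :
    F.lift m hm (F.unit x) = m x := by
  have h : ∑ i, F.y i * ι (F.E (F.x i)) = 1 := by simpa using F.sum_right 1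
  simp only [lift, LinearMap.coe_mk, AddHom.coe_mk, unit_val, hm, smul_smul]
  rw [← Finset.sum_smul, h, one_smul]

theorem linearMap_ext {ψ φ : coind ι X →ₗ[A] M} (h : ∀ x, ψ (F.unit x) = φ (F.unit x)) :
    ψ = φ := by
  refine LinearMap.ext fun f => ?_
  rw [← F.sum_smul_unit f]
  simp [_root_.map_sum, h]

end Lift

section Generator

variable {Λ A X : Type u} [Ring Λ] [Ring A] [AddCommGroup X] [Module Λ X]
  {ι : Module.End Λ X →+* A}

/-- Post-composition with the action of `Λ` on `X`. -/
def postcomp (ι : Module.End Λ X →+* A) : Λ →+* Module.End A (coind ι X) where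
  toFun l :=
    { toFun := fun f => ⟨fun a => l • f.1 a, fun a b => by simp [coind.map_add],
        fun γ a => by simp [coind.map_ι_mul]⟩
      map_add' := fun f g => Subtype.ext (funext fun a => smul_add _ _ _)
      map_smul' := fun a f => rfl }
  map_one' := LinearMap.ext fun f => Subtype.ext (funext fun a => one_smul _ _)
  map_mul' l m := LinearMap.ext fun f => Subtype.ext (funext fun a => mul_smul _ _ _)
  map_zero' := LinearMap.ext fun f => Subtype.ext (funext fun a => zero_smul _ _)
  map_add' l m := LinearMap.ext fun f => Subtype.ext (funext fun a => add_smul _ _ _)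

@[simp]
theorem postcomp_val (l : Λ) (f : coind ι X) (a : A) : (postcomp ι l f).1 a = l • f.1 a := rfl

theorem unit_smul_left (F : FrobeniusSystem ι) (l : Λ) (x : X) :
    F.unit (l • x) = postcomp ι l (F.unit x) :=
  Subtype.ext (funext fun a => by simp)

theorem eq_zero_of_forall_val (F : FrobeniusSystem ι) {a : A}
    (h : ∀ f : coind ι X, f.1 a = 0) : a = 0 := by
  have hE : ∀ b, F.E (a * b) = 0 := fun b => LinearMap.ext fun x => by
    simpa using h (b • F.unit x)
  rw [← F.sum_left a]
  simp [hE]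

/-- The `A`-linear functional on the coinduced module attached to a `Λ`-linear functional
on `X`. -/
def coord (F : FrobeniusSystem ι) (g : X →ₗ[Λ] Λ) : coind ι X →ₗ[A] A :=
  F.lift
    { toFun := fun x => ι (g.smulRight x)
      map_zero' := by simp
      map_add' := fun x z => by
        rw [← _root_.map_add]
        exact congrArg ι (LinearMap.ext fun w => smul_add _ _ _) }
    fun γ x => by
      rw [smul_eq_mul, AddMonoidHom.coe_mk, ZeroHom.coe_mk, ← map_mul]
      exact congrArg ι (LinearMap.ext fun w => by simp)

theorem coord_unit (F : FrobeniusSystem ι) (g : X →ₗ[Λ] Λ) (x : X) :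
    F.coord g (F.unit x) = ι (g.smulRight x) :=
  F.lift_unit _ _ x

variable {n : ℕ} {u : Fin n → X} {g : Fin n → X →ₗ[Λ] Λ}

theorem sum_smul_of_generator (hug : ∑ j, g j (u j) = 1) (x : X) :
    ∑ j, g j (u j) • x = x := by
  rw [← Finset.sum_smul, hug, one_smul]

theorem eq_of_forall_smul (hug : ∑ j, g j (u j) = 1) {l m : Λ}
    (h : ∀ x : X, l • x = m • x) : l = m := by
  calc l = ∑ j, g j (l • u j) := by simp [← Finset.mul_sum, hug]
    _ = ∑ j, g j (m • u j) := by simp only [h]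
    _ = m := by simp [← Finset.mul_sum, hug]

theorem sum_coord_smul (F : FrobeniusSystem ι) (hug : ∑ j, g j (u j) = 1) (f : coind ι X) :
    ∑ j, F.coord (g j) f • F.unit (u j) = f := by
  have h : ∑ j, (LinearMap.toSpanSingleton A _ (F.unit (u j))).comp (F.coord (g j)) =
      LinearMap.id := by
    refine F.linearMap_ext fun x => ?_
    simp only [LinearMap.sum_apply, LinearMap.comp_apply, coord_unit,
      LinearMap.toSpanSingleton_apply, ← unit_smul, LinearMap.id_apply]
    rw [← _root_.map_sum]
    simp [sum_smul_of_generator hug]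
  simpa [LinearMap.sum_apply] using LinearMap.congr_fun h f

theorem eq_zero_of_forall_end (F : FrobeniusSystem ι) (hug : ∑ j, g j (u j) = 1) {d : coind ι X}
    (h : ∀ ψ : Module.End A (coind ι X), (ψ d).1 1 = 0) : d = 0 := by
  rw [← F.sum_coord_smul hug d]
  refine Finset.sum_eq_zero fun j _ => ?_
  rw [F.eq_zero_of_forall_val (a := F.coord (g j) d) fun q => by
    simpa using h ((LinearMap.toSpanSingleton A _ q).comp (F.coord (g j))), zero_smul]

theorem toModuleEnd_bijective (F : FrobeniusSystem ι) (hug : ∑ j, g j (u j) = 1) :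
    Function.Bijective
      (Module.toModuleEnd (Module.End A (coind ι X)) (S := A) (coind ι X)) := by
  constructor
  · rw [injective_iff_map_eq_zero]
    refine fun a ha => F.eq_zero_of_forall_val fun f => ?_
    have h : a • f = 0 := LinearMap.congr_fun ha f
    simpa using congrFun (congrArg Subtype.val h) 1
  · intro φ
    have hφ : ∀ (ψ : Module.End A (coind ι X)) (f : coind ι X), φ (ψ f) = ψ (φ f) :=
      fun ψ f => φ.map_smul ψ f
    let γ : Fin F.n → Module.End Λ X := fun i =>
      { toFun := fun x => (φ (F.y i • F.unit x)).1 1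
        map_add' := fun x z => by simp
        map_smul' := fun l x => by
          rw [unit_smul_left, ← map_smul, hφ, postcomp_val, RingHom.id_apply] }
    let a : A := ∑ i, ι (γ i) * F.x i
    have ha : ∀ f : coind ι X, (φ f).1 1 = f.1 a := fun f => by
      conv_lhs => rw [← F.sum_smul_unit f]
      simp [a, coind.map_sum, coind.map_ι_mul, γ]
    refine ⟨a, LinearMap.ext fun f => ?_⟩
    refine sub_eq_zero.mp (F.eq_zero_of_forall_end hug fun ψ => ?_)
    have h : (ψ (a • f)).1 1 = (ψ (φ f)).1 1 := by
      rw [map_smul, coind.smul_val, one_mul, ← ha, hφ]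
    rw [map_sub]
    exact sub_eq_zero.mpr h

theorem injective_end (F : FrobeniusSystem ι) (hug : ∑ j, g j (u j) = 1)
    (hΛ : Module.Injective Λ Λ) :
    Module.Injective (Module.End A (coind ι X)) (Module.End A (coind ι X)) := by
  let T : Module.End A (coind ι X) →+ Λ :=
    { toFun := fun ψ => ∑ j, g j ((ψ (F.unit (u j))).1 1)
      map_zero' := by simp
      map_add' := fun ψ φ => by simp [Finset.sum_add_distrib] }
  have hT : ∀ ψ x, T ψ • x = (ψ (F.unit x)).1 1 := fun ψ x => by
    have hx : ∑ j, ((g j).smulRight x : Module.End Λ X) • u j = x := by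
      simpa using sum_smul_of_generator hug x
    conv_rhs => rw [← hx]
    simp only [_root_.map_sum, unit_smul, map_smul, coind.sum_val, coind.smul_val, one_mul]
    simp only [T, AddMonoidHom.coe_mk, ZeroHom.coe_mk, Finset.sum_smul]
    refine Finset.sum_congr rfl fun j _ => ?_
    simpa using (coind.map_ι_mul (ψ (F.unit (u j))) ((g j).smulRight x) 1).symm
  refine injective_of_frobenius_form hΛ (postcomp ι) T (fun l ψ => ?_) (fun h hh => ?_)
    fun s hs => ?_
  · simp [T, Finset.mul_sum]
  · let c : Fin F.n → Fin n → X →ₗ[Λ] Λ := fun i j =>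
      { toFun := fun x =>
          h ((LinearMap.toSpanSingleton A _ (F.y i • F.unit x)).comp (F.coord (g j)))
        map_add' := fun x z => by
          rw [← _root_.map_add]
          congr 1
          ext f : 1
          simp
        map_smul' := fun l x => by
          rw [RingHom.id_apply, smul_eq_mul, ← hh]
          congr 1
          ext f : 1
          simp [unit_smul_left] }
    have hc : ∀ ψ, h ψ = ∑ j, ∑ i, c i j ((ψ (F.unit (u j))).1 (F.x i)) := fun ψ => by
      simp only [c, LinearMap.coe_mk, AddHom.coe_mk, ← _root_.map_sum]
      congr 1
      refine LinearMap.ext fun f => ?_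
      simp only [LinearMap.sum_apply, LinearMap.comp_apply, LinearMap.toSpanSingleton_apply,
        ← Finset.smul_sum, F.sum_smul_unit]
      conv_lhs => rw [← F.sum_coord_smul hug f]
      simp only [_root_.map_sum, map_smul]
    let m : X →+ coind ι X :=
      { toFun := fun z => ∑ j, ∑ i, (ι ((c i j).smulRight z) * F.x i) • F.unit (u j)
        map_zero' := by simp
        map_add' := fun z w => by
          have hzw : ∀ i j, ((c i j).smulRight (z + w) : Module.End Λ X) =
              (c i j).smulRight z + (c i j).smulRight w :=
            fun i j => LinearMap.ext fun v => smul_add _ _ _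
          simp only [hzw, _root_.map_add, add_mul, add_smul, Finset.sum_add_distrib] }
    have hm : ∀ (γ : Module.End Λ X) (z : X), m (γ • z) = ι γ • m z := fun γ z => by
      have hγ : ∀ i j, ((c i j).smulRight (γ • z) : Module.End Λ X) =
          γ * (c i j).smulRight z := fun i j => LinearMap.ext fun v => by simp
      simp only [m, AddMonoidHom.coe_mk, ZeroHom.coe_mk, hγ, map_mul, Finset.smul_sum,
        smul_smul, mul_assoc]
    refine ⟨F.lift m hm, fun ψ => eq_of_forall_smul hug fun z => ?_⟩
    rw [hT, Module.End.mul_apply, lift_unit, hc]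
    simp [m, coind.map_ι_mul, Finset.sum_smul]
  · refine F.linearMap_ext fun x => F.eq_zero_of_forall_end hug fun ψ => ?_
    rw [← Module.End.mul_apply, ← hT, hs, zero_smul]

end Generator

end FrobeniusSystem

theorem stmt12 (k : Type u) [Field k]
    (A B : Type u) [Ring A] [Ring B] [Algebra k A] [Algebra k B]
    [FiniteDimensional k A] [FiniteDimensional k B]
    (ι : B →ₐ[k] A) (hinj : Function.Injective ι)
    (hfrob : IsFrobeniusRingHom ι.toRingHom)
    (hB : IsMoritaAlgebra k B) : IsMoritaAlgebra k A := by
  obtain ⟨Λ, _, _, -, hΛ, X, _, _, -, ⟨n, f, g, hgf⟩, ⟨σ⟩⟩ := hB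
  obtain ⟨F₀⟩ := hfrob.nonempty_frobeniusSystem
  let ι' : Module.End Λ X →+* A := ι.toRingHom.comp σ.symm.toRingHom
  let F : FrobeniusSystem ι' := F₀.congr σ
  let u : Fin n → X := f 1
  let c : Fin n → X →ₗ[Λ] Λ := fun j => g ∘ₗ LinearMap.single Λ (fun _ => X) j
  have huc : ∑ j, c j (u j) = 1 := by
    have h : ∑ j, (Pi.single j (u j) : Fin n → X) = f 1 := Finset.univ_sum_single (f 1)
    calc ∑ j, c j (u j) = g (∑ j, Pi.single j (u j)) := by simp [c, map_sum]
      _ = 1 := by rw [h]; exact LinearMap.congr_fun hgf 1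
  let : Module k (coind ι' X) := Module.compHom _ (algebraMap k A)
  have : IsScalarTower k A (coind ι' X) := ⟨fun r a p => by
    rw [Algebra.smul_def, mul_smul]; rfl⟩
  have : Module.Finite A (coind ι' X) := by
    refine Module.Finite.of_surjective (Fintype.linearCombination A fun j => F.unit (u j)) ?_
    exact fun p => ⟨fun j => F.coord (c j) p, F.sum_coord_smul huc p⟩
  have : Module.Finite k (coind ι' X) := Module.Finite.trans A _
  have : SMulCommClass A k (coind ι' X) := IsScalarTower.to_smulCommClass'
  have hfin : FiniteDimensional k (Module.End A (coind ι' X)) :=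
    FiniteDimensional.of_injective (LinearMap.restrictScalarsₗ k A _ _ k)
      (LinearMap.restrictScalars_injective k)
  refine ⟨Module.End A (coind ι' X), inferInstance, inferInstance, hfin,
    F.injective_end huc hΛ, coind ι' X, inferInstance, inferInstance,
    Module.Finite.of_restrictScalars_finite k _ _, ⟨n, ?_, ?_, ?_⟩,
    ⟨RingEquiv.ofBijective _ (F.toModuleEnd_bijective huc)⟩⟩
  · exact LinearMap.pi fun j => LinearMap.toSpanSingleton _ _ (F.unit (u j))
  · exact
      { toFun := fun q => ∑ j, (LinearMap.toSpanSingleton A _ (q j)).comp (F.coord (c j))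
        map_add' := fun q r => LinearMap.ext fun p => by
          simp [LinearMap.sum_apply, Finset.sum_add_distrib]
        map_smul' := fun ψ q => LinearMap.ext fun p => by
          simp [LinearMap.sum_apply] }
  · refine LinearMap.ext fun ψ => LinearMap.ext fun p => ?_
    have h := congrArg ψ (F.sum_coord_smul huc p)
    simpa [LinearMap.sum_apply] using h
end

section
/- Let A be an Artin algebra and M an A-A-bimodule that is finitely generated projective as a left A-module and as a right A-module. Then domdim(A ⋉ M) ≤ domdim(A). Moreover, if M ≅ Ae as A-A-bimodules for some central idempotent e ∈ A, then domdim(A ⋉ M) = domdim(A). -/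
/-!
Statement 16: Let `A` be an Artin algebra and `M` an `A`-`A`-bimodule which is finitely
generated projective as a left and as a right `A`-module.  Then
`domdim(A ⋉ M) ≤ domdim(A)`; if moreover `M ≅ Ae` as bimodules for a central idempotent
`e ∈ A`, then `domdim(A ⋉ M) = domdim(A)`.
-/

universe u
open MulOpposite
/-- `domdimGE R n M` holds iff there is an exact sequence
`0 → M → I^0 → ⋯ → I^(n-1)` of left `R`-modules in which every `I^j` is both
projective and injective; i.e. the dominant dimension of `M` is at least `n`. -/
def domdimGE (R : Type u) [Ring R] :
    ℕ → (M : Type u) → [AddCommGroup M] → [Module R M] → Prop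
  | 0, _, _, _ => True
  | (n+1), M, iM, mM =>
      letI := iM; letI := mM
      ∃ (I : Type u) (_ : AddCommGroup I) (_ : Module R I),
        Module.Projective R I ∧ Module.Injective R I ∧
        ∃ f : M →ₗ[R] I, Function.Injective f ∧ domdimGE R n (I ⧸ LinearMap.range f)

section DominantDimension

variable {R : Type u} [Ring R]

theorem Module.Injective.prod {I J : Type u} [AddCommGroup I] [Module R I] [AddCommGroup J]
    [Module R J] (hI : Module.Injective R I) (hJ : Module.Injective R J) :
    Module.Injective R (I × J) where
  out _ _ _ _ _ _ f hf g := by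
    obtain ⟨h₁, H₁⟩ := hI.out f hf (LinearMap.fst R I J ∘ₗ g)
    obtain ⟨h₂, H₂⟩ := hJ.out f hf (LinearMap.snd R I J ∘ₗ g)
    exact ⟨h₁.prod h₂, fun x => Prod.ext (H₁ x) (H₂ x)⟩

theorem domdimGE.congr {n : ℕ} {M N : Type u} [AddCommGroup M] [Module R M] [AddCommGroup N]
    [Module R N] (e : M ≃ₗ[R] N) (h : domdimGE R n M) : domdimGE R n N := by
  cases n with
  | zero => trivial
  | succ n =>
    obtain ⟨I, _, _, hP, hI, f, hf, hq⟩ := h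
    refine ⟨I, _, _, hP, hI, f ∘ₗ e.symm.toLinearMap, hf.comp e.symm.injective, ?_⟩
    have hr : LinearMap.range (f ∘ₗ e.symm.toLinearMap) = LinearMap.range f :=
      LinearMap.range_comp_of_range_eq_top f e.symm.range
    rwa [hr]

theorem domdimGE.of_ker_eq {n : ℕ} {W C D : Type u} [AddCommGroup W] [Module R W]
    [AddCommGroup C] [Module R C] [AddCommGroup D] [Module R D]
    (p : W →ₗ[R] C) (hp : Function.Surjective p) (q : W →ₗ[R] D) (hq : Function.Surjective q)
    (hker : LinearMap.ker p = LinearMap.ker q) (h : domdimGE R n C) : domdimGE R n D :=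
  h.congr <| (p.quotKerEquivOfSurjective hp).symm ≪≫ₗ Submodule.quotEquivOfEq _ _ hker ≪≫ₗ
    q.quotKerEquivOfSurjective hq

theorem domdimGE.succ_of_exact {n : ℕ} {X I C : Type u} [AddCommGroup X] [Module R X]
    [AddCommGroup I] [Module R I] [AddCommGroup C] [Module R C]
    (hP : Module.Projective R I) (hI : Module.Injective R I)
    (f : X →ₗ[R] I) (hf : Function.Injective f) (g : I →ₗ[R] C) (hg : Function.Surjective g)
    (hfg : Function.Exact f g) (h : domdimGE R n C) : domdimGE R (n + 1) X :=
  ⟨I, _, _, hP, hI, f, hf, h.of_ker_eq g hg _ (Submodule.mkQ_surjective _)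
    (by rw [Submodule.ker_mkQ, hfg.linearMap_ker_eq])⟩

theorem domdimGE.prod_projective_injective {n : ℕ} {X P : Type u} [AddCommGroup X] [Module R X]
    [AddCommGroup P] [Module R P] (hP : Module.Projective R P) (hI : Module.Injective R P)
    (h : domdimGE R n X) : domdimGE R n (X × P) := by
  cases n with
  | zero => trivial
  | succ n =>
    obtain ⟨I, _, _, hP', hI', f, hf, hq⟩ := h
    refine succ_of_exact (I := I × P) inferInstance (hI'.prod hI) (f.prodMap LinearMap.id)
      (hf.prodMap Function.injective_id) ((LinearMap.range f).mkQ ∘ₗ LinearMap.fst R I P)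
      ((Submodule.mkQ_surjective _).comp Prod.fst_surjective) ?_ hq
    rintro ⟨x, y⟩
    simp

/-- Dual Schanuel: the dominant dimension of a cokernel passes between two embeddings of the same
module into injective modules, up to adding those injective modules. -/
theorem domdimGE.schanuel {n : ℕ} {Z I J C D : Type u} [AddCommGroup Z] [Module R Z]
    [AddCommGroup I] [Module R I] [AddCommGroup J] [Module R J] [AddCommGroup C] [Module R C]
    [AddCommGroup D] [Module R D] (hI : Module.Injective R I) (hJ : Module.Injective R J)
    (f : Z →ₗ[R] I) (hf : Function.Injective f) (p : I →ₗ[R] C) (hp : Function.Surjective p)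
    (hfp : Function.Exact f p)
    (g : Z →ₗ[R] J) (hg : Function.Injective g) (q : J →ₗ[R] D) (hq : Function.Surjective q)
    (hgq : Function.Exact g q)
    (h : domdimGE R n (C × J)) : domdimGE R n (D × I) := by
  obtain ⟨α, hα⟩ := hI.out g hg f
  obtain ⟨β, hβ⟩ := hJ.out f hf g
  refine h.of_ker_eq (p.prodMap LinearMap.id) (hp.prodMap Function.surjective_id)
    (((q ∘ₗ (LinearMap.snd R I J + β ∘ₗ LinearMap.fst R I J)).prod
      (LinearMap.fst R I J - α ∘ₗ (LinearMap.snd R I J + β ∘ₗ LinearMap.fst R I J)))) ?_ ?_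
  · rintro ⟨d, x⟩
    obtain ⟨y, rfl⟩ := hq d
    refine ⟨(x + α y, y - β (x + α y)), ?_⟩
    simp
  · ext ⟨x, y⟩
    rw [LinearMap.mem_ker, LinearMap.mem_ker]
    change (p x, y) = 0 ↔ (q (y + β x), x - α (y + β x)) = 0
    rw [Prod.mk_eq_zero, Prod.mk_eq_zero]
    constructor
    · rintro ⟨hx, rfl⟩
      obtain ⟨z, rfl⟩ := (hfp x).1 hx
      simp [hβ, hα, hgq.apply_apply_eq_zero]
    · rintro ⟨hy, hx⟩
      obtain ⟨z, hz⟩ := (hgq _).1 hy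
      rw [← hz, hα, sub_eq_zero] at hx
      subst hx
      rw [hβ] at hz
      exact ⟨hfp.apply_apply_eq_zero z, by simpa using hz.symm⟩

theorem domdimGE.of_prod {n : ℕ} {X Y : Type u} [AddCommGroup X] [Module R X]
    [AddCommGroup Y] [Module R Y] (h : domdimGE R n (X × Y)) : domdimGE R n X := by
  induction n generalizing X Y with
  | zero => trivial
  | succ n ih =>
    obtain ⟨I, _, _, hP, hI, f, hf, hq⟩ := h
    have hfX : Function.Injective (f ∘ₗ LinearMap.inl R X Y) := hf.comp LinearMap.inl_injective
    have hfY : Function.Injective (f ∘ₗ LinearMap.inr R X Y) := hf.comp LinearMap.inr_injective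
    refine ⟨I, _, _, hP, hI, _, hfX, ?_⟩
    have h₁ := hq.prod_projective_injective (P := I × I) inferInstance (hI.prod hI)
    have h₂ := h₁.schanuel hI (hI.prod hI) f hf _ (Submodule.mkQ_surjective _)
      (LinearMap.exact_map_mkQ_range f)
      ((f ∘ₗ LinearMap.inl R X Y).prodMap (f ∘ₗ LinearMap.inr R X Y)) (hfX.prodMap hfY)
      ((Submodule.mkQ _).prodMap (Submodule.mkQ _))
      ((Submodule.mkQ_surjective (LinearMap.range (f ∘ₗ LinearMap.inl R X Y))).prodMap
        (Submodule.mkQ_surjective (LinearMap.range (f ∘ₗ LinearMap.inr R X Y))))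
      (by
        rintro ⟨x, y⟩
        simp [Prod.ext_iff])
    exact ih (ih h₂)

end DominantDimension

section RestrictScalars

variable {R S : Type u} [Ring R] [Ring S] (φ : R →+* S)

theorem Module.Projective.restrict_ringHom [Module R S] (hS : ∀ (a : R) (x : S), a • x = φ a * x)
    (hproj : Module.Projective R S) {N : Type u} [AddCommGroup N] [Module S N] [Module R N]
    (hN : ∀ (a : R) (x : N), a • x = φ a • x) (h : Module.Projective S N) :
    Module.Projective R N := by
  classical
  obtain ⟨s, hs⟩ := h
  have : Module.Projective R (N →₀ S) := .of_equiv (finsuppLequivDFinsupp (M := S) R).symm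
  let i : N →ₗ[R] N →₀ S :=
    { s with
      map_smul' := fun a x => by
        ext y
        simp [hN, hS] }
  let t : (N →₀ S) →ₗ[R] N :=
    { Finsupp.linearCombination S id with
      map_smul' := fun a x => by
        have : a • x = φ a • x := by
          ext y
          simp [hS]
        simp [hN, this] }
  exact .of_split i t (LinearMap.ext hs)

/-- An injective module stays injective after restriction along a ring homomorphism `R → S`
for which `S` has a finite dual basis as a right `R`-module. -/
theorem Module.Injective.restrict_ringHom {ι : Type*} [Fintype ι] (b : ι → S) (c : ι → S →+ R)
    (hc : ∀ i x a, c i (x * φ a) = c i x * a) (hbc : ∀ x, ∑ i, b i * φ (c i x) = x)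
    {N : Type u} [AddCommGroup N] [Module S N] [Module R N]
    (hN : ∀ (a : R) (x : N), a • x = φ a • x) (h : Module.Injective S N) :
    Module.Injective R N := by
  refine Module.Baer.injective fun J g => ?_
  have key (i : ι) (s x : S) : c i (s * x) = ∑ k, c i (s * b k) * c k x := by
    conv_lhs => rw [← hbc x, Finset.mul_sum, map_sum]
    simp_rw [← mul_assoc, hc]
  have hmem (x : S) (hx : x ∈ J.map φ) (i : ι) : c i x ∈ J := by
    induction hx using Submodule.span_induction generalizing i with
    | mem x hx =>
      obtain ⟨a, ha, rfl⟩ := hx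
      rw [← one_mul (φ a), hc]
      exact J.mul_mem_left _ ha
    | zero => simp
    | add x y _ _ hx hy => simpa using J.add_mem (hx i) (hy i)
    | smul s x _ hx =>
      rw [smul_eq_mul, key]
      exact J.sum_mem fun k _ => J.mul_mem_left _ (hx k)
  let H : J.map φ →ₗ[S] N :=
    { toFun := fun x => ∑ i, b i • g ⟨c i x, hmem x x.2 i⟩
      map_add' := fun x y => by
        rw [← Finset.sum_add_distrib]
        refine Finset.sum_congr rfl fun i _ => ?_
        rw [← smul_add, ← map_add]
        congr 2
        ext
        simp
      map_smul' := fun s x => by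
        have hg (i : ι) : g ⟨c i (s • x : J.map φ), hmem _ (s • x).2 i⟩ =
            ∑ k, φ (c i (s * b k)) • g ⟨c k x, hmem x x.2 k⟩ := by
          simp_rw [← hN, ← map_smul, ← map_sum]
          congr 1
          ext
          simp [key i s x]
        simp_rw [hg, Finset.smul_sum, smul_smul]
        rw [Finset.sum_comm]
        simp_rw [← Finset.sum_smul, hbc]
        simp }
  obtain ⟨H', hH'⟩ := Module.Baer.of_injective h _ H
  refine ⟨LinearMap.toSpanSingleton R N (H' 1), fun a ha => ?_⟩
  have h₁ := hH' (φ a) (Ideal.mem_map_of_mem φ ha)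
  have h₂ (i : ι) : g ⟨c i (φ a), hmem _ (Ideal.mem_map_of_mem φ ha) i⟩ =
      φ (c i 1) • g ⟨a, ha⟩ := by
    rw [← hN, ← map_smul]
    congr 1
    ext
    simp [← hc]
  have h₃ : H ⟨φ a, Ideal.mem_map_of_mem φ ha⟩ = g ⟨a, ha⟩ := by
    change ∑ i, b i • g ⟨c i (φ a), _⟩ = _
    simp_rw [h₂, smul_smul, ← Finset.sum_smul, hbc, one_smul]
  rw [LinearMap.toSpanSingleton_apply, hN, ← map_smul, smul_eq_mul, mul_one, h₁, h₃]

theorem domdimGE.restrict_ringHom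
    (hproj : ∀ (N : Type u) [AddCommGroup N] [Module S N] [Module R N],
      (∀ (a : R) (x : N), a • x = φ a • x) → Module.Projective S N → Module.Projective R N)
    (hinj : ∀ (N : Type u) [AddCommGroup N] [Module S N] [Module R N],
      (∀ (a : R) (x : N), a • x = φ a • x) → Module.Injective S N → Module.Injective R N)
    {n : ℕ} {N : Type u} [AddCommGroup N] [Module S N] [Module R N]
    (hN : ∀ (a : R) (x : N), a • x = φ a • x) (h : domdimGE S n N) : domdimGE R n N := by
  induction n generalizing N with
  | zero => trivial
  | succ n ih =>
    obtain ⟨I, _, _, hP, hI, f, hf, hq⟩ := h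
    obtain ⟨C, _, _, g, hg, hfg, hC⟩ : ∃ (C : Type u) (_ : AddCommGroup C) (_ : Module S C)
        (g : I →ₗ[S] C), Function.Surjective g ∧ Function.Exact f g ∧ domdimGE S n C :=
      ⟨_, _, _, _, Submodule.mkQ_surjective _, LinearMap.exact_map_mkQ_range f, hq⟩
    let : Module R I := Module.compHom I φ
    let : Module R C := Module.compHom C φ
    exact succ_of_exact (hproj I (fun _ _ => rfl) hP) (hinj I (fun _ _ => rfl) hI)
      { f with map_smul' := fun a x => by rw [hN]; exact f.map_smul (φ a) x } hf
      { g with map_smul' := fun a x => g.map_smul (φ a) x } hg hfg (ih (fun _ _ => rfl) hC)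

end RestrictScalars

theorem domdimGE_of_domdimGE_trivSqZeroExt {A M : Type u} [Ring A] [AddCommGroup M] [Module A M]
    [Module Aᵐᵒᵖ M] [SMulCommClass A Aᵐᵒᵖ M] [Module.Projective A M] [Module.Finite Aᵐᵒᵖ M]
    [Module.Projective Aᵐᵒᵖ M] {n : ℕ}
    (h : domdimGE (TrivSqZeroExt A M) n (TrivSqZeroExt A M)) : domdimGE A n A := by
  have hsmul (a : A) (x : TrivSqZeroExt A M) : a • x = TrivSqZeroExt.inlHom A M a * x := by
    ext <;> simp
  have hproj : Module.Projective A (TrivSqZeroExt A M) :=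
    inferInstanceAs (Module.Projective A (A × M))
  obtain ⟨m, f, g, -, -, hfg⟩ := Module.Finite.exists_comp_eq_id_of_projective Aᵐᵒᵖ M
  let b : Option (Fin m) → TrivSqZeroExt A M :=
    fun i => i.elim 1 fun j => TrivSqZeroExt.inr (f (Pi.single j 1))
  let c : Option (Fin m) → TrivSqZeroExt A M →+ A := fun i => i.elim
    { toFun := TrivSqZeroExt.fst, map_zero' := rfl, map_add' := fun _ _ => rfl }
    fun j => { toFun := fun x => unop (g x.snd j), map_zero' := by simp,
               map_add' := fun _ _ => by simp }
  have hc (i x a) : c i (x * TrivSqZeroExt.inlHom A M a) = c i x * a := by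
    cases i with
    | none =>
      change (x * TrivSqZeroExt.inlHom A M a).fst = x.fst * a
      simp
    | some j => simp [c]
  have hc_none (x) : c none x = x.fst := rfl
  have hbc (x) : ∑ i, b i * TrivSqZeroExt.inlHom A M (c i x) = x := by
    rw [Fintype.sum_option]
    ext
    · simp [b, hc_none, TrivSqZeroExt.fst_sum]
    · have hx : ∑ j, g x.snd j • f (Pi.single j 1) = x.snd := by
        conv_rhs => rw [← LinearMap.id_apply (R := Aᵐᵒᵖ) x.snd, ← hfg, LinearMap.comp_apply,
          pi_eq_sum_univ' (g x.snd), map_sum]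
        simp
      simpa [b, c, hc_none, TrivSqZeroExt.snd_sum] using hx
  have h₁ : domdimGE A n (TrivSqZeroExt A M) := h.restrict_ringHom (TrivSqZeroExt.inlHom A M)
    (fun N _ _ _ hN hP => hproj.restrict_ringHom _ hsmul hN hP)
    (fun N _ _ _ hN hI => hI.restrict_ringHom _ b c hc hbc hN) hsmul
  exact domdimGE.of_prod (Y := M) (h₁ : domdimGE A n (A × M))

/-- An isomorphism of bimodules from `M` onto `Ae`, for a central idempotent `e` of `A`. -/
structure CentralIdempotentIso (A M : Type u) [Ring A] [AddCommGroup M] [Module A M]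
    [Module Aᵐᵒᵖ M] where
  /-- The idempotent. -/
  e : A
  idem : e * e = e
  comm : ∀ a : A, a * e = e * a
  /-- The isomorphism, as a map into `A`. -/
  φ : M →+ A
  injective : Function.Injective φ
  map_smul : ∀ (a : A) (m : M), φ (a • m) = a * φ m
  map_op_smul : ∀ (a : A) (m : M), φ (op a • m) = φ m * a
  mem_range : ∀ x : A, x * e = x ↔ ∃ m : M, φ m = x

namespace CentralIdempotentIso

variable {A M : Type u} [Ring A] [AddCommGroup M] [Module A M] [Module Aᵐᵒᵖ M]
  (d : CentralIdempotentIso A M)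

theorem φ_mul_e (m : M) : d.φ m * d.e = d.φ m := (d.mem_range _).2 ⟨m, rfl⟩

theorem e_mul_φ (m : M) : d.e * d.φ m = d.φ m := by rw [← d.comm, φ_mul_e]

/-- The element of `M` corresponding to `e`. -/
noncomputable def gen : M := ((d.mem_range d.e).1 d.idem).choose

@[simp] theorem φ_gen : d.φ d.gen = d.e := ((d.mem_range d.e).1 d.idem).choose_spec

theorem φ_smul_gen (m : M) : d.φ m • d.gen = m := d.injective <| by
  rw [d.map_smul, φ_gen, φ_mul_e]

theorem op_φ_smul_gen (m : M) : op (d.φ m) • d.gen = m := d.injective <| by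
  rw [d.map_op_smul, φ_gen, e_mul_φ]

theorem op_smul_gen (a : A) : op a • d.gen = a • d.gen := d.injective <| by
  rw [d.map_op_smul, d.map_smul, φ_gen, d.comm]

open TrivSqZeroExt in
theorem eq_inl_add (b : TrivSqZeroExt A M) :
    b = inl b.fst + inl (d.φ b.snd) * inr d.gen := by
  ext <;> simp [φ_smul_gen]

open TrivSqZeroExt in
theorem inr_gen_mul (b : TrivSqZeroExt A M) :
    inr d.gen * b = inl b.fst * inr d.gen := by
  ext <;> simp [op_smul_gen]

open TrivSqZeroExt in
theorem inl_e_mul_inr_gen : inl d.e * inr d.gen = (inr d.gen : TrivSqZeroExt A M) := by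
  ext
  · simp
  · simpa using d.φ_smul_gen d.gen

/-- The summand `eX` of an `A`-module `X`. -/
def part (X : Type u) [AddCommGroup X] [Module A X] : AddSubgroup X where
  carrier := {y | d.e • y = y}
  zero_mem' := smul_zero _
  add_mem' hx hy := by simp_all
  neg_mem' hx := by simp_all

theorem mem_part {X : Type u} [AddCommGroup X] [Module A X] {y : X} :
    y ∈ d.part X ↔ d.e • y = y := Iff.rfl

theorem smul_mem_part {X : Type u} [AddCommGroup X] [Module A X] (a : A) {y : X}
    (hy : y ∈ d.part X) : a • y ∈ d.part X := by
  rw [mem_part] at *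
  rw [smul_smul, ← d.comm, mul_smul, hy]

theorem φ_smul_mem_part {X : Type u} [AddCommGroup X] [Module A X] (m : M) (y : X) :
    d.φ m • y ∈ d.part X := by
  rw [mem_part, smul_smul, e_mul_φ]

theorem φ_mem_part (m : M) : d.φ m ∈ d.part A := d.e_mul_φ m

theorem e_smul_mem_part {X : Type u} [AddCommGroup X] [Module A X] (y : X) :
    d.e • y ∈ d.part X := by
  rw [mem_part, smul_smul, d.idem]

/-- The `A ⋉ M`-module induced from an `A`-module `X`, realised on `X ⊕ eX`. -/
def Induced (X : Type u) [AddCommGroup X] [Module A X] : Type u :=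
  X × d.part X

variable {X Y : Type u} [AddCommGroup X] [Module A X] [AddCommGroup Y] [Module A Y]

instance : AddCommGroup (d.Induced X) := inferInstanceAs (AddCommGroup (X × d.part X))

variable {d} in
/-- The component in `X` of an element of `X ⊕ eX`. -/
def Induced.base : d.Induced X →+ X := AddMonoidHom.fst X (d.part X)

variable {d} in
/-- The component in `eX` of an element of `X ⊕ eX`. -/
def Induced.top : d.Induced X →+ X := (d.part X).subtype.comp (AddMonoidHom.snd X (d.part X))

/-- The element of `X ⊕ eX` with given components. -/
def pair (x y : X) (hy : y ∈ d.part X) : d.Induced X := (x, ⟨y, hy⟩)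

@[simp] theorem base_pair (x y : X) (hy : y ∈ d.part X) : (d.pair x y hy).base = x := rfl

@[simp] theorem top_pair (x y : X) (hy : y ∈ d.part X) : (d.pair x y hy).top = y := rfl

variable {d} in
theorem Induced.ext {p q : d.Induced X} (h₁ : p.base = q.base) (h₂ : p.top = q.top) : p = q :=
  Prod.ext h₁ (Subtype.ext h₂)

variable {d} in
theorem Induced.top_mem (p : d.Induced X) : p.top ∈ d.part X := p.2.2

variable {d} in
theorem Induced.e_smul_top (p : d.Induced X) : d.e • p.top = p.top := p.top_mem

instance : SMul (TrivSqZeroExt A M) (d.Induced X) where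
  smul b p := d.pair (b.fst • p.base) (b.fst • p.top + d.φ b.snd • p.base)
    (add_mem (d.smul_mem_part _ p.top_mem) (d.φ_smul_mem_part _ _))

@[simp] theorem base_smul (b : TrivSqZeroExt A M) (p : d.Induced X) :
    (b • p).base = b.fst • p.base := rfl

@[simp] theorem top_smul (b : TrivSqZeroExt A M) (p : d.Induced X) :
    (b • p).top = b.fst • p.top + d.φ b.snd • p.base := rfl

variable [SMulCommClass A Aᵐᵒᵖ M]

instance : Module (TrivSqZeroExt A M) (d.Induced X) where
  one_smul p := by apply Induced.ext <;> simp
  mul_smul a b p := by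
    apply Induced.ext
    · simp [mul_smul]
    · simp [mul_smul, d.map_smul, d.map_op_smul, add_smul, add_assoc]
  smul_zero a := by apply Induced.ext <;> simp
  smul_add a p q := by
    apply Induced.ext
    · simp
    · simp only [top_smul, map_add, smul_add]
      abel
  add_smul a b p := by
    apply Induced.ext
    · simp [add_smul]
    · simp only [top_smul, map_add, add_smul, TrivSqZeroExt.fst_add, TrivSqZeroExt.snd_add]
      abel
  zero_smul p := by apply Induced.ext <;> simp

/-- Functoriality of induction. -/
def map (f : X →ₗ[A] Y) : d.Induced X →ₗ[TrivSqZeroExt A M] d.Induced Y where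
  toFun p := d.pair (f p.base) (f p.top) (by rw [mem_part, ← LinearMap.map_smul, p.top_mem])
  map_add' p q := by apply Induced.ext <;> simp
  map_smul' b p := by apply Induced.ext <;> simp

@[simp] theorem base_map (f : X →ₗ[A] Y) (p : d.Induced X) : (d.map f p).base = f p.base := rfl

@[simp] theorem top_map (f : X →ₗ[A] Y) (p : d.Induced X) : (d.map f p).top = f p.top := rfl

theorem map_injective (f : X →ₗ[A] Y) (hf : Function.Injective f) :
    Function.Injective (d.map f) := fun _ _ h =>
  Induced.ext (hf (congrArg Induced.base h)) (hf (congrArg Induced.top h))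

theorem map_surjective (f : X →ₗ[A] Y) (hf : Function.Surjective f) :
    Function.Surjective (d.map f) := fun q => by
  obtain ⟨x, hx⟩ := hf q.base
  obtain ⟨y, hy⟩ := hf q.top
  refine ⟨d.pair x (d.e • y) (d.e_smul_mem_part y), Induced.ext (by simpa) ?_⟩
  simpa [hy] using q.e_smul_top

theorem map_exact {Z : Type u} [AddCommGroup Z] [Module A Z] (f : X →ₗ[A] Y) (g : Y →ₗ[A] Z)
    (h : Function.Exact f g) : Function.Exact (d.map f) (d.map g) := fun q => by
  constructor
  · intro hq
    obtain ⟨x, hx⟩ := (h q.base).1 (congrArg Induced.base hq)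
    obtain ⟨y, hy⟩ := (h q.top).1 (congrArg Induced.top hq)
    refine ⟨d.pair x (d.e • y) (d.e_smul_mem_part y), Induced.ext (by simpa) ?_⟩
    simpa [hy] using q.e_smul_top
  · rintro ⟨p, rfl⟩
    apply Induced.ext <;> simp [h.apply_apply_eq_zero]

open TrivSqZeroExt in
theorem induced_projective (h : Module.Projective A X) :
    Module.Projective (TrivSqZeroExt A M) (d.Induced X) := by
  refine .of_lifting_property fun {N L} _ _ _ _ g h hg => ?_
  let : Module A N := Module.compHom N (inlHom A M)
  let : Module A L := Module.compHom L (inlHom A M)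
  let g' : N →ₗ[A] L := { g with map_smul' := fun a x => g.map_smul (inl a) x }
  let h' : X →ₗ[A] L :=
    { toFun := fun x => h (d.pair x 0 (zero_mem _))
      map_add' := fun x y => by
        rw [← map_add]
        congr 1
        apply Induced.ext <;> simp
      map_smul' := fun a x => by
        change _ = (inl a : TrivSqZeroExt A M) • h (d.pair x 0 (zero_mem _))
        rw [← LinearMap.map_smul]
        congr 1
        apply Induced.ext <;> simp }
  obtain ⟨u, hu⟩ := Module.projective_lifting_property g' h' hg
  replace hu (x) : g (u x) = h (d.pair x 0 (zero_mem _)) := LinearMap.congr_fun hu x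
  have hsmul (a : A) (x : X) : u (a • x) = (inl a : TrivSqZeroExt A M) • u x := u.map_smul a x
  refine ⟨{ toFun := fun p => u p.base + (inr d.gen : TrivSqZeroExt A M) • u p.top,
            map_add' := ?_, map_smul' := ?_ }, ?_⟩
  · intro p q
    simp only [map_add, smul_add]
    abel
  · intro b p
    conv_rhs => rw [RingHom.id_apply, smul_add, smul_smul, d.eq_inl_add b]
    have h₀ : (inl (d.φ b.snd) * inr d.gen : TrivSqZeroExt A M) * inr d.gen = 0 := by
      rw [mul_assoc, inr_mul_inr, mul_zero]
    rw [add_mul, h₀, add_zero, base_smul, top_smul, map_add, hsmul, hsmul, hsmul, smul_add,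
      smul_smul, smul_smul, inr_gen_mul, inr_gen_mul, add_smul]
    simp only [fst_inl]
    abel
  · ext p
    simp only [LinearMap.comp_apply, LinearMap.coe_mk, AddHom.coe_mk, map_add, LinearMap.map_smul,
      hu]
    rw [← LinearMap.map_smul, ← map_add]
    congr 1
    apply Induced.ext
    · simp
    · simpa using p.e_smul_top

open TrivSqZeroExt in
theorem induced_injective (h : Module.Injective A X) :
    Module.Injective (TrivSqZeroExt A M) (d.Induced X) where
  out N L _ _ _ _ f hf v := by
    let : Module A N := Module.compHom N (inlHom A M)
    let : Module A L := Module.compHom L (inlHom A M)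
    let f' : N →ₗ[A] L := { f with map_smul' := fun a x => f.map_smul (inl a) x }
    have hv (a : A) (n : N) : v (a • n) = (inl a : TrivSqZeroExt A M) • v n := v.map_smul _ n
    have hcomm (a : A) (x : X) : d.e • a • x = a • d.e • x := by
      rw [smul_smul, smul_smul, d.comm]
    let w : N →ₗ[A] X :=
      { toFun := fun n => (v n).top + ((v n).base - d.e • (v n).base)
        map_add' := fun x y => by
          simp only [map_add, smul_add]
          abel
        map_smul' := fun a x => by
          simp [hv, smul_add, smul_sub, hcomm] }
    obtain ⟨w', hw'⟩ := h.out f' hf w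
    replace hw' (n : N) : w' (f n) = (v n).top + ((v n).base - d.e • (v n).base) := hw' n
    have hs (a : A) (l : L) : w' ((inl a : TrivSqZeroExt A M) • l) = a • w' l := w'.map_smul a l
    let ε : TrivSqZeroExt A M := inr d.gen
    have hε (l : L) : d.e • w' (ε • l) = w' (ε • l) := by
      rw [← hs, smul_smul, inl_e_mul_inr_gen]
    have hεε (l : L) : ε • ε • l = 0 := by
      rw [smul_smul, inr_mul_inr, zero_smul]
    have hw_smul (b : TrivSqZeroExt A M) (l : L) :
        w' (b • l) = b.fst • w' l + d.φ b.snd • w' (ε • l) := by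
      conv_lhs => rw [d.eq_inl_add b, add_smul, mul_smul, map_add, hs, hs]
    have hwε_smul (b : TrivSqZeroExt A M) (l : L) :
        w' (ε • b • l) = b.fst • w' (ε • l) := by
      rw [smul_smul, inr_gen_mul, mul_smul, hs]
    have hφ (m : M) (x : X) : d.e • d.φ m • x = d.φ m • x := d.φ_smul_mem_part m x
    have hφ' (m : M) (x : X) : d.φ m • d.e • x = d.φ m • x := by rw [smul_smul, φ_mul_e]
    refine ⟨{ toFun := fun l => d.pair (w' (ε • l) + (w' l - d.e • w' l)) (d.e • w' l)
                (d.e_smul_mem_part _), map_add' := ?_, map_smul' := ?_ }, ?_⟩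
    · intro l l'
      apply Induced.ext
      · simp only [base_pair, map_add, smul_add]
        abel
      · simp
    · intro b l
      apply Induced.ext
      · simp only [base_pair, RingHom.id_apply, base_smul, hw_smul b, hwε_smul, smul_add, smul_sub,
          hφ, hcomm]
        abel
      · simp only [top_pair, base_pair, RingHom.id_apply, top_smul, hw_smul b, smul_add, smul_sub,
          hφ, hφ', hcomm]
        abel
    · intro n
      have h₁ : d.e • (v n).top = (v n).top := (v n).e_smul_top
      have h₂ : d.e • d.e • (v n).base = d.e • (v n).base := by rw [smul_smul, d.idem]
      apply Induced.ext
      · change w' (ε • f n) + (w' (f n) - d.e • w' (f n)) = _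
        rw [← LinearMap.map_smul f, hw', hw', LinearMap.map_smul]
        simp [ε, smul_add, smul_sub, h₁, h₂]
      · change d.e • w' (f n) = _
        simp [hw', smul_add, smul_sub, h₁, h₂]

theorem domdimGE_induced {n : ℕ} (h : domdimGE A n X) :
    domdimGE (TrivSqZeroExt A M) n (d.Induced X) := by
  induction n generalizing X with
  | zero => trivial
  | succ n ih =>
    obtain ⟨I, _, _, hP, hI, f, hf, hq⟩ := h
    exact domdimGE.succ_of_exact (d.induced_projective hP) (d.induced_injective hI) (d.map f)
      (d.map_injective f hf) (d.map (LinearMap.range f).mkQ)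
      (d.map_surjective _ (Submodule.mkQ_surjective _))
      (d.map_exact _ _ (LinearMap.exact_map_mkQ_range f)) (ih hq)

/-- The comparison map from the regular module of `A ⋉ M` to the module induced from `A`. -/
def regularHom : TrivSqZeroExt A M →ₗ[TrivSqZeroExt A M] d.Induced A where
  toFun b := d.pair b.fst (d.φ b.snd) (d.φ_mem_part b.snd)
  map_add' p q := by
    apply Induced.ext
    · simp only [map_add, base_pair, TrivSqZeroExt.fst_add]
    · simp only [map_add, top_pair, TrivSqZeroExt.snd_add]
  map_smul' b p := by
    apply Induced.ext
    · simp only [RingHom.id_apply, base_smul, base_pair, smul_eq_mul, TrivSqZeroExt.fst_mul]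
    · simp only [RingHom.id_apply, top_smul, base_pair, top_pair, smul_eq_mul,
        TrivSqZeroExt.snd_mul, map_add, d.map_smul, d.map_op_smul]

theorem base_regularHom (b : TrivSqZeroExt A M) : (d.regularHom b).base = b.fst := rfl

theorem top_regularHom (b : TrivSqZeroExt A M) : (d.regularHom b).top = d.φ b.snd := rfl

/-- The regular module of `A ⋉ M` is induced from the regular module of `A`. -/
noncomputable def regularEquiv : TrivSqZeroExt A M ≃ₗ[TrivSqZeroExt A M] d.Induced A :=
  LinearEquiv.ofBijective d.regularHom
    ⟨fun _ _ h => TrivSqZeroExt.ext (congrArg Induced.base h)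
        (d.injective (congrArg Induced.top h)), fun p => by
      obtain ⟨m, hm⟩ := (d.mem_range p.top).1 ((d.comm _).trans p.e_smul_top)
      exact ⟨TrivSqZeroExt.inl p.base + TrivSqZeroExt.inr m,
        Induced.ext (by simp [base_regularHom]) (by simp [top_regularHom, hm])⟩⟩

end CentralIdempotentIso

theorem stmt16 (k : Type u) [CommRing k] [IsArtinianRing k]
    (A : Type u) [Ring A] [Algebra k A] [Module.Finite k A]
    (M : Type u) [AddCommGroup M] [Module A M] [Module Aᵐᵒᵖ M] [SMulCommClass A Aᵐᵒᵖ M]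
    [Module.Finite A M] (hlproj : Module.Projective A M)
    [Module.Finite Aᵐᵒᵖ M] (hrproj : Module.Projective Aᵐᵒᵖ M) :
    (∀ n : ℕ, domdimGE (TrivSqZeroExt A M) n (TrivSqZeroExt A M) → domdimGE A n A) ∧
    ((∃ e : A, e * e = e ∧ (∀ a : A, a * e = e * a) ∧
        ∃ φ : M →+ A, Function.Injective φ ∧
          (∀ (a : A) (m : M), φ (a • m) = a * φ m) ∧
          (∀ (a : A) (m : M), φ (op a • m) = φ m * a) ∧
          (∀ x : A, x * e = x ↔ ∃ m : M, φ m = x)) →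
      ∀ n : ℕ, domdimGE (TrivSqZeroExt A M) n (TrivSqZeroExt A M) ↔ domdimGE A n A) := by
  refine ⟨fun n h => domdimGE_of_domdimGE_trivSqZeroExt h, ?_⟩
  rintro ⟨e, idem, comm, φ, hφ, hl, hr, hmem⟩ n
  let d : CentralIdempotentIso A M := ⟨e, idem, comm, φ, hφ, hl, hr, hmem⟩
  exact ⟨fun h => domdimGE_of_domdimGE_trivSqZeroExt h,
    fun h => (d.domdimGE_induced h).congr d.regularEquiv.symm⟩
end

section
/- Let k be a field of characteristic zero and 𝔤 a nonzero finite-dimensional semisimple Lie algebra over k (i.e. of rank r ≥ 1), and let U(𝔤) be its universal enveloping algebra. Then fdd(U(𝔤)) = 1, both for U(𝔤) as a left module over itself and as a right module over itself; in particular U(𝔤) is a QF-3 ring. -/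
/-!
Statement 19: Let `𝔤` be a nonzero finite-dimensional semisimple Lie algebra over a field
`k` of characteristic zero.  Then the flat-dominant dimension of `U(𝔤)` equals `1`, both as
a left and as a right module over itself; in particular `U(𝔤)` is a QF-3 ring.
-/

universe u
open MulOpposite
/-- The subgroup of "balanced relations" in `M ⊗[ℤ] X`, for `M` a right `R`-module and
`X` a left `R`-module.  The quotient of `M ⊗[ℤ] X` by this subgroup is the tensor product
`M ⊗_R X` over the (possibly noncommutative) ring `R`. -/
def balRel (R : Type u) [Ring R] (M : Type u) [AddCommGroup M] [Module Rᵐᵒᵖ M]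
    (X : Type u) [AddCommGroup X] [Module R X] : Submodule ℤ (TensorProduct ℤ M X) :=
  Submodule.span ℤ
    {z | ∃ (m : M) (r : R) (x : X), z = m ⊗ₜ[ℤ] (r • x) - ((op r) • m) ⊗ₜ[ℤ] x}

/-- Scalar multiplication `I ⊗[ℤ] F → F`, `i ⊗ v ↦ i • v`, for a right ideal `I` of `R`. -/
noncomputable def idealSmul (R : Type u) [Ring R] (F : Type u) [AddCommGroup F] [Module R F]
    (I : Submodule Rᵐᵒᵖ R) : TensorProduct ℤ (↥I) F →ₗ[ℤ] F :=
  TensorProduct.lift (AddMonoidHom.toIntLinearMap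
    { toFun := fun i => AddMonoidHom.toIntLinearMap
        { toFun := fun v => (i : R) • v
          map_zero' := smul_zero _
          map_add' := fun v w => smul_add _ _ _ }
      map_zero' := by ext v; simp
      map_add' := fun i j => by ext v; simp [add_smul] })

/-- A left module `F` over a (possibly noncommutative) ring `R` is flat if for every
finitely generated right ideal `I` of `R` the canonical map `I ⊗_R F → F` is injective.
Since `I ⊗_R F` is the quotient of `I ⊗[ℤ] F` by the balanced relations (all of which are
killed by `idealSmul`), this injectivity says exactly that the kernel of `idealSmul`
is contained in the subgroup of balanced relations. -/
def ModFlat (R : Type u) [Ring R] (F : Type u) [AddCommGroup F] [Module R F] : Prop :=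
  ∀ I : Submodule Rᵐᵒᵖ R, I.FG →
    LinearMap.ker (idealSmul R F I) ≤ balRel R (↥I) F

/-- `fddGE R n M` holds iff there is an exact sequence
`0 → M → I^0 → ⋯ → I^(n-1)` of left `R`-modules in which every `I^j` is both
flat and injective; i.e. the (left) flat-dominant dimension of `M` is at least `n`. -/
def fddGE (R : Type u) [Ring R] :
    ℕ → (M : Type u) → [AddCommGroup M] → [Module R M] → Prop
  | 0, _, _, _ => True
  | (n+1), M, iM, mM =>
      letI := iM; letI := mM
      ∃ (I : Type u) (_ : AddCommGroup I) (_ : Module R I),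
        ModFlat R I ∧ Module.Injective R I ∧
        ∃ f : M →ₗ[R] I, Function.Injective f ∧ fddGE R n (I ⧸ LinearMap.range f)


open scoped nonZeroDivisors in
/-- A domain satisfying the left Ore condition embeds in a division ring of left fractions. -/
theorem exists_divisionRing_of_leftOre (R : Type u) [Ring R] [Nontrivial R] [NoZeroDivisors R]
    (hl : ∀ a b : R, a ≠ 0 → b ≠ 0 → ∃ c d, c * a = d * b ∧ c * a ≠ 0) :
    ∃ (Q : Type u) (_ : DivisionRing Q) (f : R →+* Q), Function.Injective f ∧
      ∀ q, ∃ s r, s ≠ 0 ∧ f s * q = f r := by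
  have hne : Nonempty (OreLocalization.OreSet R⁰) := by
    rw [OreLocalization.nonempty_oreSet_iff_of_noZeroDivisors]
    intro r s
    by_cases hr : r = 0
    · exact ⟨0, 1, by simp [hr]⟩
    obtain ⟨c, d, h, h0⟩ := hl r s hr (nonZeroDivisors.ne_zero s.2)
    exact ⟨d, ⟨c, mem_nonZeroDivisors_of_ne_zero (left_ne_zero_of_mul h0)⟩, h⟩
  obtain ⟨_⟩ := hne
  refine ⟨OreLocalization R⁰ R, inferInstance, OreLocalization.numeratorRingHom,
    OreLocalization.numeratorHom_inj inf_le_left, fun q => ?_⟩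
  induction q using OreLocalization.ind with
  | _ r s =>
    refine ⟨s, r, nonZeroDivisors.ne_zero s.2, ?_⟩
    change OreLocalization.numeratorHom (s : R) * _ = OreLocalization.numeratorHom r
    simp only [OreLocalization.numeratorHom_apply]
    exact OreLocalization.mul_cancel

theorem idealSmul_tmul (R : Type u) [Ring R] (F : Type u) [AddCommGroup F] [Module R F]
    (I : Submodule Rᵐᵒᵖ R) (i : I) (v : F) : idealSmul R F I (i ⊗ₜ v) = (i : R) • v := rfl

theorem idealSmul_eq_zero_of_mem_balRel (R : Type u) [Ring R] (F : Type u) [AddCommGroup F]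
    [Module R F] (I : Submodule Rᵐᵒᵖ R) {z : TensorProduct ℤ I F} (hz : z ∈ balRel R I F) :
    idealSmul R F I z = 0 := by
  change z ∈ LinearMap.ker (idealSmul R F I)
  revert z
  rw [← SetLike.le_def, balRel, Submodule.span_le]
  rintro _ ⟨m, r, x, rfl⟩
  simp [idealSmul_tmul, mul_smul]

/-- The division ring of fractions of a two-sided Ore domain is flat. -/
theorem modFlat_divisionRing (R : Type u) [Ring R] [Nontrivial R] [NoZeroDivisors R]
    (hr : ∀ a b : R, a ≠ 0 → b ≠ 0 → ∃ c d, a * c = b * d ∧ a * c ≠ 0)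
    (Q : Type u) [DivisionRing Q] [Module R Q] (f : R →+* Q) (hf : Function.Injective f)
    (hsmul : ∀ r q, r • q = f r * q) (hfrac : ∀ q, ∃ s r, s ≠ 0 ∧ f s * q = f r) :
    ModFlat R Q := by
  have hf0 : ∀ r, r ≠ 0 → f r ≠ 0 := fun r h => (map_ne_zero_iff f hf).2 h
  have hfrac' : ∀ q, ∃ t r, t ≠ 0 ∧ q = f r * (f t)⁻¹ := by
    intro q
    obtain ⟨s, r, hs, h⟩ := hfrac q
    by_cases hr0 : r = 0
    · refine ⟨1, 0, one_ne_zero, ?_⟩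
      have := hf0 s hs
      simp_all
    obtain ⟨c, d, hcd, h0⟩ := hr r s hr0 hs
    have hc : c ≠ 0 := right_ne_zero_of_mul h0
    refine ⟨c, d, hc, ?_⟩
    rw [eq_mul_inv_iff_mul_eq₀ (hf0 c hc)]
    apply mul_left_cancel₀ (hf0 s hs)
    rw [← mul_assoc, h, ← map_mul, ← map_mul, hcd]
  intro I _ z hz
  have key : ∀ z : TensorProduct ℤ I Q, ∃ (i : I) (t : R), t ≠ 0 ∧
      z - i ⊗ₜ (f t)⁻¹ ∈ balRel R I Q := by
    have hrel : ∀ (m : I) (r : R) (x : Q),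
        m ⊗ₜ[ℤ] (r • x) - ((op r) • m) ⊗ₜ[ℤ] x ∈ balRel R I Q := fun m r x =>
      Submodule.subset_span ⟨m, r, x, rfl⟩
    intro z
    induction z with
    | zero => exact ⟨0, 1, one_ne_zero, by simp⟩
    | tmul i q =>
      obtain ⟨t, r, ht, rfl⟩ := hfrac' q
      refine ⟨op r • i, t, ht, ?_⟩
      rw [← hsmul]
      exact hrel _ _ _
    | add x y hx hy =>
      obtain ⟨i, s, hs, hx⟩ := hx
      obtain ⟨j, t, ht, hy⟩ := hy
      obtain ⟨a, b, hab, h0⟩ := hr s t hs ht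
      refine ⟨op a • i + op b • j, s * a, h0, ?_⟩
      have e1 : (f s)⁻¹ = a • (f (s * a))⁻¹ := by
        have ha := hf0 a (right_ne_zero_of_mul h0)
        rw [hsmul, map_mul, mul_inv_rev, mul_inv_cancel_left₀ ha]
      have e2 : (f t)⁻¹ = b • (f (s * a))⁻¹ := by
        have hb := hf0 b (right_ne_zero_of_mul (hab ▸ h0))
        rw [hsmul, hab, map_mul, mul_inv_rev, mul_inv_cancel_left₀ hb]
      have h1 := hrel i a (f (s * a))⁻¹
      have h2 := hrel j b (f (s * a))⁻¹
      rw [← e1] at h1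
      rw [← e2] at h2
      convert add_mem (add_mem hx hy) (add_mem h1 h2) using 1
      rw [TensorProduct.add_tmul]
      abel
  obtain ⟨i, t, ht, h⟩ := key z
  have h' := idealSmul_eq_zero_of_mem_balRel R Q I h
  rw [map_sub, LinearMap.mem_ker.1 hz, idealSmul_tmul, hsmul, zero_sub, neg_eq_zero] at h'
  have hi : i = 0 := by
    have := (mul_eq_zero.1 h').resolve_right (inv_ne_zero (hf0 t ht))
    exact Subtype.ext ((map_eq_zero_iff f hf).1 this)
  simpa [hi] using h

/-- A division ring containing a left Ore domain is injective as a left module. -/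
theorem injective_divisionRing (R : Type u) [Ring R] [Nontrivial R] [NoZeroDivisors R]
    (hl : ∀ a b : R, a ≠ 0 → b ≠ 0 → ∃ c d, c * a = d * b ∧ c * a ≠ 0)
    (Q : Type u) [DivisionRing Q] [Module R Q] (f : R →+* Q) (hf : Function.Injective f)
    (hsmul : ∀ r q, r • q = f r * q) : Module.Injective R Q := by
  have hf0 : ∀ r, r ≠ 0 → f r ≠ 0 := fun r h => (map_ne_zero_iff f hf).2 h
  apply Module.Baer.injective
  intro I g
  by_cases hI : I = ⊥
  · refine ⟨0, fun x hx => ?_⟩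
    have : (⟨x, hx⟩ : I) = 0 := by subst hI; exact Subtype.ext hx
    rw [this]; simp
  obtain ⟨a, haI, ha⟩ := Submodule.exists_mem_ne_zero_of_ne_bot hI
  refine ⟨LinearMap.toSpanSingleton R Q ((f a)⁻¹ * g ⟨a, haI⟩), fun b hb => ?_⟩
  rw [LinearMap.toSpanSingleton_apply, hsmul]
  by_cases hb0 : b = 0
  · subst hb0
    have : (⟨0, hb⟩ : I) = 0 := rfl
    rw [this]; simp
  obtain ⟨c, d, hcd, h0⟩ := hl a b ha hb0
  have hd : d ≠ 0 := left_ne_zero_of_mul (hcd ▸ h0)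
  apply mul_left_cancel₀ (hf0 d hd)
  have e : c • (⟨a, haI⟩ : I) = d • ⟨b, hb⟩ := Subtype.ext hcd
  have e' := congrArg g e
  rw [map_smul, map_smul, hsmul, hsmul] at e'
  rw [← e', ← mul_assoc, ← map_mul, ← hcd, map_mul, mul_assoc, mul_inv_cancel_left₀ (hf0 a ha)]

theorem fddGE_one_of_ore (R : Type u) [Ring R] [Nontrivial R] [NoZeroDivisors R]
    (hl : ∀ a b : R, a ≠ 0 → b ≠ 0 → ∃ c d, c * a = d * b ∧ c * a ≠ 0)
    (hr : ∀ a b : R, a ≠ 0 → b ≠ 0 → ∃ c d, a * c = b * d ∧ a * c ≠ 0)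
    (M : Type u) [AddCommGroup M] [Module R M] (e : M ≃ₗ[R] R) : fddGE R 1 M := by
  obtain ⟨Q, _, f, hf, hfrac⟩ := exists_divisionRing_of_leftOre R hl
  let : Module R Q := Module.compHom Q f
  have hsmul : ∀ (r : R) (q : Q), r • q = f r * q := fun _ _ => rfl
  refine ⟨Q, inferInstance, inferInstance, modFlat_divisionRing R hr Q f hf hsmul hfrac,
    injective_divisionRing R hl Q f hf hsmul,
    LinearMap.toSpanSingleton R Q 1 ∘ₗ e.toLinearMap, ?_, trivial⟩
  refine Function.Injective.comp (g := LinearMap.toSpanSingleton R Q 1) ?_ e.injective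
  intro a b h
  apply hf
  simpa [hsmul] using h

/-- Flat modules over a domain are torsion-free. -/
theorem ModFlat.smul_eq_zero (R : Type u) [Ring R] [NoZeroDivisors R] (F : Type u)
    [AddCommGroup F] [Module R F] (hF : ModFlat R F) {a : R} (ha : a ≠ 0) {v : F}
    (h : a • v = 0) : v = 0 := by
  have : IsCancelMulZero R := NoZeroDivisors.toIsCancelMulZero
  let I : Submodule Rᵐᵒᵖ R := Submodule.span Rᵐᵒᵖ {a}
  have hmem : ∀ i : I, ∃ r : R, a * r = i := fun i => by
    obtain ⟨r, hr⟩ := Submodule.mem_span_singleton.1 i.2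
    exact ⟨r.unop, hr⟩
  choose φ hφ using hmem
  have haI : a ∈ I := Submodule.mem_span_singleton_self a
  have hφadd : ∀ i j, φ (i + j) = φ i + φ j := fun i j => by
    apply mul_left_cancel₀ ha
    rw [mul_add, hφ, hφ, hφ]; rfl
  have hφmul : ∀ i r, φ (op r • i) = φ i * r := fun i r => by
    apply mul_left_cancel₀ ha
    rw [← mul_assoc, hφ, hφ]; rfl
  have hφa : φ ⟨a, haI⟩ = 1 := by
    apply mul_left_cancel₀ ha
    rw [hφ, mul_one]
  let Φ : TensorProduct ℤ I F →ₗ[ℤ] F := TensorProduct.lift (AddMonoidHom.toIntLinearMap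
    (AddMonoidHom.mk' (fun i => AddMonoidHom.toIntLinearMap
      (AddMonoidHom.mk' (fun v => φ i • v) fun v w => smul_add _ _ _))
      fun i j => by ext v; simp [add_smul, hφadd]))
  have hΦ : ∀ i v, Φ (i ⊗ₜ v) = φ i • v := fun _ _ => rfl
  have hker : balRel R I F ≤ LinearMap.ker Φ := by
    rw [balRel, Submodule.span_le]
    rintro _ ⟨m, r, x, rfl⟩
    simp [hΦ, hφmul, mul_smul]
  have := hker (hF I (Submodule.fg_span_singleton a) (x := (⟨a, haI⟩ : I) ⊗ₜ v)
    (by simpa [idealSmul_tmul] using h))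
  simpa [hΦ, hφa] using this

/-- Injective modules over a domain are divisible. -/
theorem Module.Injective.exists_smul_eq (R : Type u) [Ring R] [NoZeroDivisors R] (E : Type u)
    [AddCommGroup E] [Module R E] (hE : Module.Injective R E) {a : R} (ha : a ≠ 0) (x : E) :
    ∃ y, a • y = x := by
  have : IsCancelMulZero R := NoZeroDivisors.toIsCancelMulZero
  obtain ⟨h, hh⟩ := hE.out (LinearMap.toSpanSingleton R R a)
    (fun r s hrs => mul_right_cancel₀ ha (by simpa using hrs)) (LinearMap.toSpanSingleton R E x)
  refine ⟨h 1, ?_⟩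
  have := hh 1
  simp only [LinearMap.toSpanSingleton_apply, one_smul] at this
  rw [← map_smul, ← this, smul_eq_mul, mul_one]

theorem not_fddGE_two_of_not_isUnit (R : Type u) [Ring R] [NoZeroDivisors R]
    {a : R} (ha : a ≠ 0) (hu : ∀ b, a * b ≠ 1)
    (M : Type u) [AddCommGroup M] [Module R M] (e : M ≃ₗ[R] R) : ¬ fddGE R 2 M := by
  rintro ⟨I, _, _, -, hI, f, hf, J, _, _, hJ, -, g, hg, -⟩
  obtain ⟨y, hy⟩ := hI.exists_smul_eq R I ha (f (e.symm 1))
  have h0 : (Submodule.Quotient.mk y : I ⧸ LinearMap.range f) = 0 := by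
    apply hg
    rw [map_zero]
    apply hJ.smul_eq_zero R J ha
    rw [← map_smul, ← Submodule.Quotient.mk_smul, hy,
      (Submodule.Quotient.mk_eq_zero (LinearMap.range f)).2 (LinearMap.mem_range_self f _), map_zero]
  obtain ⟨m, rfl⟩ := (Submodule.Quotient.mk_eq_zero _).1 h0
  rw [← map_smul] at hy
  have := congrArg e (hf hy)
  rw [map_smul, e.apply_symm_apply] at this
  exact hu _ this

/-- The span of the words of length less than `n` in the elements `e i`. -/
def wordFil (k : Type*) [CommSemiring k] {A ι : Type*} [Semiring A] [Algebra k A] (e : ι → A)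
    (n : ℕ) : Submodule k A :=
  Submodule.span k {x | ∃ l : List ι, l.length < n ∧ (l.map e).prod = x}

section WordFil

variable {k A ι : Type*} [Field k] [Ring A] [Algebra k A] {e : ι → A}

theorem prod_mem_wordFil {n : ℕ} {l : List ι} (h : l.length < n) :
    (l.map e).prod ∈ wordFil k e n :=
  Submodule.subset_span ⟨l, h, rfl⟩

theorem wordFil_mono {m n : ℕ} (h : m ≤ n) : wordFil k e m ≤ wordFil k e n :=
  Submodule.span_mono fun _ ⟨l, hl, hx⟩ => ⟨l, hl.trans_le h, hx⟩

theorem wordFil_zero : wordFil k e 0 = ⊥ := by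
  simp [wordFil]

theorem mul_mem_wordFil {m n : ℕ} {x y : A} (hx : x ∈ wordFil k e (m + 1))
    (hy : y ∈ wordFil k e n) : x * y ∈ wordFil k e (m + n) := by
  have h : x * y ∈ wordFil k e (m + 1) * wordFil k e n := Submodule.mul_mem_mul hx hy
  refine (?_ : wordFil k e (m + 1) * wordFil k e n ≤ wordFil k e (m + n)) h
  rw [wordFil, wordFil, Submodule.span_mul_span, Submodule.span_le]
  rintro _ ⟨_, ⟨l, hl, rfl⟩, _, ⟨l', hl', rfl⟩, rfl⟩
  refine Submodule.subset_span ⟨l ++ l', ?_, by simp⟩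
  simp only [List.length_append]
  omega

theorem prod_sub_prod_mem_wordFil_of_perm
    (hcomm : ∀ i j, e i * e j - e j * e i ∈ wordFil k e 2) {l l' : List ι} (h : l.Perm l') :
    (l.map e).prod - (l'.map e).prod ∈ wordFil k e l.length := by
  induction h with
  | nil => simp
  | cons i h ih =>
    rw [List.map_cons, List.map_cons, List.prod_cons, List.prod_cons, ← mul_sub, List.length_cons,
      add_comm]
    refine mul_mem_wordFil ?_ ih
    simpa using prod_mem_wordFil (k := k) (e := e) (n := 2) (l := [i]) (by simp)
  | swap i j l =>
    have := mul_mem_wordFil (hcomm j i) (prod_mem_wordFil (k := k) (e := e) (lt_add_one l.length))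
    convert this using 1
    · simp only [List.length_cons]
      congr 1
      omega
    · simp [sub_mul, mul_assoc]
  | trans h₁ _ ih₁ ih₂ =>
    rw [← h₁.length_eq] at ih₂
    simpa using add_mem ih₁ ih₂

theorem exists_mem_wordFil (hspan : ∀ x : A, x ∈ Submodule.span k
    (Set.range fun l : List ι => (l.map e).prod)) (x : A) : ∃ n, x ∈ wordFil k e n := by
  induction hspan x using Submodule.span_induction with
  | mem x h =>
    obtain ⟨l, rfl⟩ := h
    exact ⟨_, prod_mem_wordFil (lt_add_one _)⟩
  | zero => exact ⟨0, zero_mem _⟩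
  | add x y _ _ hx hy =>
    obtain ⟨m, hx⟩ := hx
    obtain ⟨n, hy⟩ := hy
    exact ⟨max m n, add_mem (wordFil_mono (le_max_left _ _) hx)
      (wordFil_mono (le_max_right _ _) hy)⟩
  | smul a x _ hx => exact hx.imp fun _ h => Submodule.smul_mem _ _ h

theorem exists_mem_wordFil_succ_notMem (hspan : ∀ x : A, x ∈ Submodule.span k
    (Set.range fun l : List ι => (l.map e).prod)) {x : A} (hx : x ≠ 0) :
    ∃ n, x ∈ wordFil k e (n + 1) ∧ x ∉ wordFil k e n := by
  classical
  have h := exists_mem_wordFil hspan x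
  obtain ⟨m, hm⟩ : ∃ m, Nat.find h = m + 1 := by
    refine Nat.exists_eq_succ_of_ne_zero fun h0 => hx ?_
    simpa [h0, wordFil_zero] using Nat.find_spec h
  exact ⟨m, hm ▸ Nat.find_spec h, Nat.find_min h (by omega)⟩

/-- Words of length at most `n` are spanned by one word for each exponent vector. -/
theorem wordFil_le_span_range [Fintype ι] [DecidableEq ι]
    (hcomm : ∀ i j, e i * e j - e j * e i ∈ wordFil k e 2) (n N : ℕ) (hn : n ≤ N) :
    wordFil k e n ≤ Submodule.span k (Set.range fun f : ι → Fin N =>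
      ((∑ i, (f i : ℕ) • {i} : Multiset ι).toList.map e).prod) := by
  induction n with
  | zero => simp [wordFil_zero]
  | succ n ih =>
    refine Submodule.span_le.2 ?_
    rintro _ ⟨l, hl, rfl⟩
    have hperm : l.Perm (l : Multiset ι).toList := by
      rw [← Multiset.coe_eq_coe, Multiset.coe_toList]
    have h1 := ih (by omega) (wordFil_mono (Nat.le_of_lt_succ hl)
      (prod_sub_prod_mem_wordFil_of_perm hcomm hperm))
    have h2 : ((l : Multiset ι).toList.map e).prod ∈ Submodule.span k
        (Set.range fun f : ι → Fin N =>
          ((∑ i, (f i : ℕ) • {i} : Multiset ι).toList.map e).prod) := by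
      refine Submodule.subset_span ⟨fun i => ⟨(l : Multiset ι).count i, ?_⟩, ?_⟩
      · have := Multiset.count_le_card i (l : Multiset ι)
        rw [Multiset.coe_card] at this
        omega
      · have : ∑ i, (l : Multiset ι).count i • {i} = (l : Multiset ι) := by
          ext j
          simp [Multiset.count_sum', Multiset.count_singleton]
        simp only [this]
    simpa using add_mem h1 h2

theorem finrank_wordFil_le [Fintype ι]
    (hcomm : ∀ i j, e i * e j - e j * e i ∈ wordFil k e 2) (n : ℕ) :
    FiniteDimensional k (wordFil k e n) ∧
      Module.finrank k (wordFil k e n) ≤ n ^ Fintype.card ι := by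
  classical
  have h := wordFil_le_span_range hcomm n n le_rfl
  have hfin := FiniteDimensional.span_of_finite k (Set.finite_range fun f : ι → Fin n =>
      ((∑ i, (f i : ℕ) • {i} : Multiset ι).toList.map e).prod)
  refine ⟨Submodule.finiteDimensional_of_le h, (Submodule.finrank_mono h).trans ?_⟩
  refine (finrank_range_le_card _).trans ?_
  simp

/-- Two injective endomorphisms of bounded degree of a filtered space of polynomial growth have
intersecting ranges. -/
theorem exists_map_eq_map_of_polynomial_growth {V : Type*} [AddCommGroup V] [Module k V]
    (F : ℕ → Submodule k V) (d : ℕ) (hF : ∀ n, FiniteDimensional k (F n) ∧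
      Module.finrank k (F n) ≤ n ^ d) (hF1 : F 1 ≠ ⊥)
    (φ ψ : V →ₗ[k] V) (hφ : Function.Injective φ) (hψ : Function.Injective ψ) (c : ℕ)
    (hφF : ∀ n, ∀ x ∈ F n, φ x ∈ F (n + c)) (hψF : ∀ n, ∀ x ∈ F n, ψ x ∈ F (n + c)) :
    ∃ x y, φ x = ψ y ∧ φ x ≠ 0 := by
  by_contra! hcon
  have hdouble : ∀ n, 2 * Module.finrank k (F n) ≤ Module.finrank k (F (n + c)) := by
    intro n
    have := (hF n).1
    have := (hF (n + c)).1
    have hmap : (F n).map φ ⊔ (F n).map ψ ≤ F (n + c) := by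
      refine sup_le ?_ ?_
      · rintro _ ⟨x, hx, rfl⟩
        exact hφF n x hx
      · rintro _ ⟨x, hx, rfl⟩
        exact hψF n x hx
    have hbot : (F n).map φ ⊓ (F n).map ψ = ⊥ := by
      rw [eq_bot_iff]
      rintro _ ⟨⟨x, -, rfl⟩, ⟨y, -, hy⟩⟩
      exact hcon x y hy.symm
    have h1 := Submodule.finrank_sup_add_finrank_inf_eq ((F n).map φ) ((F n).map ψ)
    rw [hbot, finrank_bot, ← (Submodule.equivMapOfInjective φ hφ (F n)).finrank_eq,
      ← (Submodule.equivMapOfInjective ψ hψ (F n)).finrank_eq] at h1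
    have h2 := Submodule.finrank_mono hmap
    omega
  have hpow : ∀ i, 2 ^ i ≤ Module.finrank k (F (1 + i * c)) := by
    intro i
    induction i with
    | zero =>
      have := (hF 1).1
      have : Module.finrank k (F 1) ≠ 0 := fun h => hF1 (Submodule.finrank_eq_zero.1 h)
      rw [pow_zero, zero_mul, add_zero]
      exact Nat.pos_of_ne_zero this
    | succ i ih =>
      have := hdouble (1 + i * c)
      rw [show 1 + (i + 1) * c = 1 + i * c + c by ring, pow_succ]
      omega
  have hle : ∀ i, 2 ^ i ≤ (1 + i * c) ^ d := fun i => (hpow i).trans (hF _).2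
  have hlim := tendsto_pow_const_div_const_pow_of_one_lt d (r := (2 : ℝ)) one_lt_two
  have hlt := hlim.eventually (gt_mem_nhds (show (0 : ℝ) < 1 / ((1 + c : ℝ) ^ d) by positivity))
  obtain ⟨i, hi, hi1⟩ := (hlt.and (Filter.eventually_ge_atTop 1)).exists
  have h1 : ((2 : ℝ) ^ i) ≤ (1 + i * c) ^ d := by exact_mod_cast hle i
  have h2 : (1 + i * c : ℝ) ^ d ≤ (i * (1 + c)) ^ d := by
    have : (1 : ℝ) ≤ i := by exact_mod_cast hi1
    gcongr
    linarith
  rw [div_lt_div_iff₀ (by positivity) (by positivity), ← mul_pow] at hi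
  linarith

theorem leftOre_of_wordFil [Fintype ι] [Nontrivial A] [NoZeroDivisors A]
    (hcomm : ∀ i j, e i * e j - e j * e i ∈ wordFil k e 2) (hspan : ∀ x : A, x ∈ Submodule.span k
      (Set.range fun l : List ι => (l.map e).prod)) (a b : A) (ha : a ≠ 0) (hb : b ≠ 0) :
    (∃ c d, c * a = d * b ∧ c * a ≠ 0) ∧ (∃ c d, a * c = b * d ∧ a * c ≠ 0) := by
  obtain ⟨m, hm⟩ := exists_mem_wordFil hspan a
  obtain ⟨n, hn⟩ := exists_mem_wordFil hspan b
  have ha' : a ∈ wordFil k e (m + n + 1) := wordFil_mono (by omega) hm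
  have hb' : b ∈ wordFil k e (m + n + 1) := wordFil_mono (by omega) hn
  have h1 : wordFil k e 1 ≠ ⊥ := by
    refine Submodule.ne_bot_iff _ |>.2 ⟨1, ?_, one_ne_zero⟩
    simpa using prod_mem_wordFil (k := k) (e := e) (n := 1) (l := []) (by simp)
  have hinjr : ∀ x : A, x ≠ 0 → Function.Injective (LinearMap.mulRight k x) := fun x hx =>
    fun a b h => mul_right_cancel₀ hx h
  have hinjl : ∀ x : A, x ≠ 0 → Function.Injective (LinearMap.mulLeft k x) := fun x hx =>
    fun a b h => mul_left_cancel₀ hx h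
  have hr : ∀ x ∈ wordFil k e (m + n + 1), ∀ N, ∀ y ∈ wordFil k e N,
      LinearMap.mulRight k x y ∈ wordFil k e (N + (m + n + 1)) := fun x hx N y hy =>
    mul_mem_wordFil (wordFil_mono (by omega) hy) hx
  have hl : ∀ x ∈ wordFil k e (m + n + 1), ∀ N, ∀ y ∈ wordFil k e N,
      LinearMap.mulLeft k x y ∈ wordFil k e (N + (m + n + 1)) := fun x hx N y hy =>
    wordFil_mono (by omega) (mul_mem_wordFil hx hy)
  exact ⟨exists_map_eq_map_of_polynomial_growth _ _ (finrank_wordFil_le hcomm) h1 _ _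
      (hinjr a ha) (hinjr b hb) _ (hr a ha') (hr b hb'),
    exists_map_eq_map_of_polynomial_growth _ _ (finrank_wordFil_le hcomm) h1 _ _
      (hinjl a ha) (hinjl b hb) _ (hl a ha') (hl b hb')⟩

/-- `IsSymbol e c n φ` says that `φ` vanishes on words of length less than `n` and evaluates words
of length `n` at `c`. -/
def IsSymbol (e : ι → A) (c : ι → k) (n : ℕ) (φ : A →ₗ[k] k) : Prop :=
  (∀ l : List ι, l.length < n → φ (l.map e).prod = 0) ∧
    ∀ l : List ι, l.length = n → φ (l.map e).prod = (l.map c).prod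

theorem IsSymbol.apply_eq_zero {c : ι → k} {n : ℕ} {φ : A →ₗ[k] k} (h : IsSymbol e c n φ) {x : A}
    (hx : x ∈ wordFil k e n) : φ x = 0 := by
  change x ∈ LinearMap.ker φ
  revert x
  rw [← SetLike.le_def, wordFil, Submodule.span_le]
  rintro _ ⟨l, hl, rfl⟩
  exact h.1 l hl

theorem IsSymbol.apply_mul {c : ι → k} {m n : ℕ} {φ ψ χ : A →ₗ[k] k} (hφ : IsSymbol e c m φ)
    (hψ : IsSymbol e c n ψ) (hχ : IsSymbol e c (m + n) χ) {x y : A}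
    (hx : x ∈ wordFil k e (m + 1)) (hy : y ∈ wordFil k e (n + 1)) :
    χ (x * y) = φ x * ψ y := by
  induction hx, hy using Submodule.span_induction₂ with
  | mem_mem x y hx hy =>
    obtain ⟨l, hl, rfl⟩ := hx
    obtain ⟨l', hl', rfl⟩ := hy
    rw [← List.prod_append, ← List.map_append]
    by_cases h : l.length = m ∧ l'.length = n
    · rw [hφ.2 l h.1, hψ.2 l' h.2, hχ.2 _ (by simp [h.1, h.2]), List.map_append,
        List.prod_append]
    · rw [hχ.1 _ (by rw [List.length_append]; omega)]
      rcases not_and_or.1 h with h | h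
      · rw [hφ.1 l (by omega), zero_mul]
      · rw [hψ.1 l' (by omega), mul_zero]
  | zero_left => simp
  | zero_right => simp
  | add_left _ _ _ _ _ _ h₁ h₂ => simp [add_mul, h₁, h₂]
  | add_right _ _ _ _ _ _ h₁ h₂ => simp [mul_add, h₁, h₂]
  | smul_left _ _ _ _ _ h => simp [h, mul_assoc]
  | smul_right _ _ _ _ _ h => simp [h, mul_left_comm]

/-- Each element of degree `n` has a symbol polynomial, vanishing only if the degree drops. -/
theorem exists_symbol_polynomial
    (hcomm : ∀ i j, e i * e j - e j * e i ∈ wordFil k e 2) (n : ℕ) {x : A}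
    (hx : x ∈ wordFil k e (n + 1)) : ∃ p : MvPolynomial ι k,
      (p = 0 → x ∈ wordFil k e n) ∧
      ∀ (c : ι → k) (φ : A →ₗ[k] k), IsSymbol e c n φ → φ x = MvPolynomial.eval c p := by
  classical
  let P : MvPolynomial ι k →ₗ[k] A := (Finsupp.linearCombination k
    fun s : ι →₀ ℕ => ((Finsupp.toMultiset s).toList.map e).prod) ∘ₗ
      (AddMonoidAlgebra.coeffLinearEquiv k).toLinearMap
  have hP : ∀ s : ι →₀ ℕ, P (MvPolynomial.monomial s 1) =
      ((Finsupp.toMultiset s).toList.map e).prod := fun s => by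
    simp [P, MvPolynomial.monomial]
  suffices h : ∃ p : MvPolynomial ι k, x - P p ∈ wordFil k e n ∧
      ∀ (c : ι → k) (φ : A →ₗ[k] k), IsSymbol e c n φ → φ x = MvPolynomial.eval c p by
    obtain ⟨p, hp, h⟩ := h
    exact ⟨p, fun h0 => by simpa [h0] using hp, h⟩
  induction hx using Submodule.span_induction with
  | mem x h =>
    obtain ⟨l, hl, rfl⟩ := h
    by_cases hln : l.length = n
    · refine ⟨MvPolynomial.monomial (Multiset.toFinsupp (l : Multiset ι)) 1, ?_, ?_⟩
      · rw [hP, Multiset.toFinsupp_toMultiset]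
        have hperm : l.Perm (l : Multiset ι).toList := by
          rw [← Multiset.coe_eq_coe, Multiset.coe_toList]
        rw [← hln]
        exact prod_sub_prod_mem_wordFil_of_perm hcomm hperm
      · intro c φ hφ
        rw [hφ.2 l hln, MvPolynomial.eval_monomial, one_mul, ← Multiset.prod_coe,
          ← Multiset.map_coe, Finsupp.prod, Multiset.toFinsupp_support,
          Finset.prod_multiset_map_count]
        simp
    · refine ⟨0, ?_, fun c φ hφ => ?_⟩
      · simpa using prod_mem_wordFil (by omega)
      · rw [hφ.1 l (by omega), map_zero]
  | zero => exact ⟨0, by simp, by simp⟩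
  | add x y _ _ hx hy =>
    obtain ⟨p, hp, hp'⟩ := hx
    obtain ⟨q, hq, hq'⟩ := hy
    refine ⟨p + q, ?_, fun c φ h => by simp [hp' c φ h, hq' c φ h]⟩
    convert add_mem hp hq using 1
    rw [map_add]
    abel
  | smul a x _ hx =>
    obtain ⟨p, hp, hp'⟩ := hx
    refine ⟨a • p, ?_, fun c φ h => by simp [hp' c φ h]⟩
    rw [map_smul, ← smul_sub]
    exact Submodule.smul_mem _ _ hp

theorem noZeroDivisors_of_isSymbol [Infinite k]
    (hcomm : ∀ i j, e i * e j - e j * e i ∈ wordFil k e 2) (hspan : ∀ x : A, x ∈ Submodule.span k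
      (Set.range fun l : List ι => (l.map e).prod))
    (hsymb : ∀ (c : ι → k) n, ∃ φ, IsSymbol e c n φ) : NoZeroDivisors A := by
  refine ⟨fun {x y} hxy => ?_⟩
  by_contra! hne
  obtain ⟨m, hm, hm'⟩ := exists_mem_wordFil_succ_notMem hspan hne.1
  obtain ⟨n, hn, hn'⟩ := exists_mem_wordFil_succ_notMem hspan hne.2
  obtain ⟨p, hp, hp'⟩ := exists_symbol_polynomial hcomm m hm
  obtain ⟨q, hq, hq'⟩ := exists_symbol_polynomial hcomm n hn
  have hpq : p * q = 0 := by
    refine MvPolynomial.funext fun c => ?_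
    obtain ⟨φ, hφ⟩ := hsymb c m
    obtain ⟨ψ, hψ⟩ := hsymb c n
    obtain ⟨χ, hχ⟩ := hsymb c (m + n)
    rw [map_mul, ← hp' c φ hφ, ← hq' c ψ hψ, ← hφ.apply_mul hψ hχ hm hn, hxy, map_zero, map_zero]
  rcases mul_eq_zero.1 hpq with h | h
  · exact hm' (hp h)
  · exact hn' (hq h)

end WordFil

section Taylor

variable {k B : Type*} [Field k] [CommRing B] [Algebra k B]

theorem Derivation.apply_mem_pow (D : Derivation k B B) (I : Ideal B) (n : ℕ) {x : B}
    (hx : x ∈ I ^ (n + 1)) : D x ∈ I ^ n := by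
  induction n generalizing x with
  | zero => simp
  | succ n ih =>
    rw [pow_succ] at hx
    induction hx using Submodule.mul_induction_on' with
    | mem_mul_mem a ha b hb =>
      rw [Derivation.leibniz, smul_eq_mul, smul_eq_mul]
      refine add_mem (Ideal.mul_mem_right _ _ ha) ?_
      rw [pow_succ']
      exact Ideal.mul_mem_mul hb (ih ha)
    | add a _ b _ ha hb => rw [map_add]; exact add_mem ha hb

open scoped Nat in
/-- Applying `n` derivations to a divided power `f ^ (n + j) / (n + j)!` of a function `f`
vanishing at a point. -/
theorem prod_derivation_apply_pow_sub_mem [CharZero k] {ι : Type*} (D : ι → Derivation k B B)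
    (ε : B →ₐ[k] k) (f : B) (hf : ε f = 0) (l : List ι) (j : ℕ) :
    (l.map fun i => ((D i : B →ₗ[k] B) : Module.End k B)).prod
        (((l.length + j)! : k)⁻¹ • f ^ (l.length + j)) -
      (l.map fun i => ε (D i f)).prod • ((j ! : k)⁻¹ • f ^ j) ∈ RingHom.ker ε ^ (j + 1) := by
  have hfI : f ∈ RingHom.ker ε := hf
  induction l generalizing j with
  | nil => simp
  | cons i l ih =>
    have h1 := (D i).apply_mem_pow _ _ (ih (j + 1))
    have hfac : ((j + 1)! : k)⁻¹ * (j + 1 : ℕ) = (j ! : k)⁻¹ := by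
      rw [Nat.factorial_succ, Nat.cast_mul, mul_inv_rev, mul_assoc,
        inv_mul_cancel₀ (Nat.cast_ne_zero.2 j.succ_ne_zero), mul_one]
    have h2 : f ^ j * (D i f - algebraMap k B (ε (D i f))) ∈ RingHom.ker ε ^ (j + 1) := by
      rw [pow_succ]
      refine Ideal.mul_mem_mul (Ideal.pow_mem_pow hfI j) ?_
      simp [RingHom.mem_ker]
    have h3 := Submodule.smul_of_tower_mem (RingHom.ker ε ^ (j + 1))
      ((l.map fun i => ε (D i f)).prod * (j ! : k)⁻¹) h2
    convert add_mem h1 h3 using 1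
    rw [List.map_cons, List.map_cons, List.prod_cons, List.prod_cons, Module.End.mul_apply,
      List.length_cons, show l.length + 1 + j = l.length + (j + 1) by ring, map_sub,
      Derivation.map_smul, Derivation.map_smul, Derivation.leibniz_pow, Derivation.coeFn_coe,
      ← hfac]
    simp only [nsmul_eq_mul, smul_eq_mul, Nat.add_sub_cancel]
    simp only [Algebra.smul_def, map_mul, map_natCast]
    ring

/-- A representation of an algebra by products of derivations provides symbol functionals. -/
theorem exists_isSymbol_of_derivation [CharZero k] {A ι : Type*} [Ring A] [Algebra k A]
    {e : ι → A} (ρ : A →ₐ[k] Module.End k B) (D : ι → Derivation k B B)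
    (hρ : ∀ i, ρ (e i) = (D i : B →ₗ[k] B)) (ε : B →ₐ[k] k) (f : B) (hf : ε f = 0) (n : ℕ) :
    ∃ φ, IsSymbol e (fun i => ε (D i f)) n φ := by
  have hfI : f ∈ RingHom.ker ε := hf
  have hρl : ∀ l : List ι, ρ (l.map e).prod =
      (l.map fun i => ((D i : B →ₗ[k] B) : Module.End k B)).prod := fun l => by
    rw [map_list_prod, List.map_map]
    congr 1
    exact List.map_congr_left fun i _ => hρ i
  refine ⟨ε.toLinearMap ∘ₗ LinearMap.applyₗ (((n.factorial : k)⁻¹ • f ^ n : B)) ∘ₗ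
    ρ.toLinearMap, fun l hl => ?_, fun l hl => ?_⟩
  · obtain ⟨j, rfl⟩ := Nat.exists_eq_add_of_lt hl
    have h := prod_derivation_apply_pow_sub_mem D ε f hf l (j + 1)
    have h0 := Ideal.pow_le_self (Nat.succ_ne_zero _) h
    rw [RingHom.mem_ker, map_sub, sub_eq_zero] at h0
    change ε (ρ _ _) = 0
    rw [hρl, add_assoc, h0]
    simp [hf]
  · subst hl
    have h := prod_derivation_apply_pow_sub_mem D ε f hf l 0
    have h0 := Ideal.pow_le_self (Nat.succ_ne_zero _) h
    rw [RingHom.mem_ker, map_sub, sub_eq_zero] at h0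
    simpa [hρl] using h0

end Taylor

section Enveloping

attribute [local instance 100] LieRing.ofAssociativeRing

variable (k : Type*) [Field k] {L : Type*} [LieRing L] [LieAlgebra k L]

/-- The vector field on the space of matrices given by right multiplication by a matrix. -/
noncomputable def matrixVectorField {ι : Type*} [Fintype ι] (M : Matrix ι ι k) :
    Derivation k (MvPolynomial (ι × ι) k) (MvPolynomial (ι × ι) k) :=
  MvPolynomial.mkDerivation k fun p => ∑ l, M l p.2 • MvPolynomial.X (p.1, l)

/-- A matrix representation of a Lie algebra acts on polynomial functions on matrices by
derivations. -/
noncomputable def matrixVectorFieldHom {ι : Type*} [Fintype ι] [DecidableEq ι]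
    (r : L →ₗ⁅k⁆ Matrix ι ι k) : L →ₗ⁅k⁆ Module.End k (MvPolynomial (ι × ι) k) where
  toFun x := (matrixVectorField k (r x) : _ →ₗ[k] _)
  map_add' x y := by
    rw [← Derivation.coe_add_linearMap]
    congr 1
    refine MvPolynomial.derivation_ext fun p => ?_
    simp [matrixVectorField, add_smul, Finset.sum_add_distrib]
  map_smul' a x := by
    rw [RingHom.id_apply, ← Derivation.coe_smul_linearMap]
    congr 1
    refine MvPolynomial.derivation_ext fun p => ?_
    simp [matrixVectorField, mul_smul, Finset.smul_sum]
  map_lie' {x y} := by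
    change _ = ⁅((matrixVectorField k (r x) : MvPolynomial (ι × ι) k →ₗ[k] MvPolynomial (ι × ι) k) :
        Module.End k (MvPolynomial (ι × ι) k)),
      (matrixVectorField k (r y) : MvPolynomial (ι × ι) k →ₗ[k] MvPolynomial (ι × ι) k)⁆
    rw [← Derivation.commutator_coe_linear_map]
    congr 1
    refine MvPolynomial.derivation_ext fun p => ?_
    simp only [Derivation.commutator_apply, matrixVectorField, MvPolynomial.mkDerivation_X,
      map_sum, Derivation.map_smul, LieHom.map_lie, Ring.lie_def, Matrix.sub_apply, sub_smul,
      Finset.sum_sub_distrib, Matrix.mul_apply, Finset.smul_sum, Finset.sum_smul, smul_smul]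
    congr 1
    · rw [Finset.sum_comm]
      simp only [mul_comm]
    · rw [Finset.sum_comm]
      simp only [mul_comm]

theorem exists_isSymbol_of_injective [CharZero k] {ι κ : Type*} [Fintype ι] [DecidableEq ι]
    (r : L →ₗ⁅k⁆ Matrix ι ι k) (hr : Function.Injective r) (b : Module.Basis κ k L)
    (c : κ → k) (n : ℕ) :
    ∃ φ, IsSymbol (fun i => UniversalEnvelopingAlgebra.ι k (b i)) c n φ := by
  obtain ⟨g, hg⟩ := LinearMap.exists_leftInverse_of_injective (r : L →ₗ[k] Matrix ι ι k)
    (LinearMap.ker_eq_bot.2 hr)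
  let μ : Matrix ι ι k →ₗ[k] k := b.constr k c ∘ₗ g
  have hμ : ∀ i, μ (r (b i)) = c i := fun i => by
    have := LinearMap.congr_fun hg (b i)
    simp only [LinearMap.comp_apply, LieHom.coe_toLinearMap, LinearMap.id_apply] at this
    simp [μ, this]
  let ε : MvPolynomial (ι × ι) k →ₐ[k] k := MvPolynomial.aeval fun p => (1 : Matrix ι ι k) p.1 p.2
  let f₀ : MvPolynomial (ι × ι) k :=
    ∑ p : ι × ι, μ (Matrix.single p.1 p.2 1) • MvPolynomial.X p
  have key := exists_isSymbol_of_derivation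
    (e := fun i => UniversalEnvelopingAlgebra.ι k (b i))
    (UniversalEnvelopingAlgebra.lift k (matrixVectorFieldHom k r))
    (fun i => matrixVectorField k (r (b i)))
    (fun i => UniversalEnvelopingAlgebra.lift_ι_apply k _ _) ε (f₀ - MvPolynomial.C (ε f₀))
    (by rw [map_sub, sub_eq_zero, MvPolynomial.algHom_C]; rfl) n
  convert key using 4 with φ i
  rw [← hμ i, map_sub, MvPolynomial.derivation_C, sub_zero]
  conv_lhs => rw [Matrix.matrix_eq_sum_single (r (b i))]
  simp only [f₀, map_sum, Derivation.map_smul, matrixVectorField, MvPolynomial.mkDerivation_X,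
    map_smul, ε, MvPolynomial.aeval_X, Matrix.one_apply, Fintype.sum_prod_type]
  refine Finset.sum_congr rfl fun x _ => Finset.sum_congr rfl fun y _ => ?_
  rw [← mul_one (r (b i) x y), ← smul_eq_mul, ← Matrix.smul_single, map_smul]
  simp [mul_comm]

variable {k}

theorem enveloping_comm_mem_wordFil {κ : Type*} (b : Module.Basis κ k L) (i j : κ) :
    UniversalEnvelopingAlgebra.ι k (b i) * UniversalEnvelopingAlgebra.ι k (b j) -
      UniversalEnvelopingAlgebra.ι k (b j) * UniversalEnvelopingAlgebra.ι k (b i) ∈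
      wordFil k (fun i => UniversalEnvelopingAlgebra.ι k (b i)) 2 := by
  rw [← Ring.lie_def, ← LieHom.map_lie]
  generalize ⁅b i, b j⁆ = x
  induction b.mem_span x using Submodule.span_induction with
  | mem x h =>
    obtain ⟨i, rfl⟩ := h
    simpa using prod_mem_wordFil (k := k) (e := fun i => UniversalEnvelopingAlgebra.ι k (b i))
      (n := 2) (l := [i]) (by simp)
  | zero => simp
  | add x y _ _ hx hy => rw [map_add]; exact add_mem hx hy
  | smul a x _ hx => rw [map_smul]; exact Submodule.smul_mem _ _ hx

theorem UniversalEnvelopingAlgebra.adjoin_range_ι :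
    Algebra.adjoin k (Set.range (UniversalEnvelopingAlgebra.ι k : L → _)) = ⊤ := by
  let S := Algebra.adjoin k (Set.range (UniversalEnvelopingAlgebra.ι k : L → _))
  let j : L →ₗ⁅k⁆ S :=
    { toFun := fun x => ⟨UniversalEnvelopingAlgebra.ι k x, Algebra.subset_adjoin ⟨x, rfl⟩⟩
      map_add' := fun x y => Subtype.ext (map_add _ x y)
      map_smul' := fun a x => Subtype.ext (map_smul _ a x)
      map_lie' := fun {x y} => Subtype.ext (LieHom.map_lie _ x y) }
  have h : S.val.comp (UniversalEnvelopingAlgebra.lift k j) = AlgHom.id k _ := by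
    apply UniversalEnvelopingAlgebra.hom_ext
    ext x
    simp [j]
  rw [eq_top_iff]
  rintro x -
  have := AlgHom.congr_fun h x
  rw [AlgHom.id_apply] at this
  rw [← this]
  exact (UniversalEnvelopingAlgebra.lift k j x).2

theorem enveloping_mem_span_words {κ : Type*} (b : Module.Basis κ k L)
    (x : UniversalEnvelopingAlgebra k L) : x ∈ Submodule.span k (Set.range fun l : List κ =>
      (l.map fun i => UniversalEnvelopingAlgebra.ι k (b i)).prod) := by
  have h : Algebra.adjoin k (Set.range fun i => UniversalEnvelopingAlgebra.ι k (b i)) = ⊤ := by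
    rw [eq_top_iff, ← UniversalEnvelopingAlgebra.adjoin_range_ι, Algebra.adjoin_le_iff]
    rintro _ ⟨y, rfl⟩
    induction b.mem_span y using Submodule.span_induction with
    | mem y h =>
      obtain ⟨i, rfl⟩ := h
      exact Algebra.subset_adjoin ⟨i, rfl⟩
    | zero => rw [map_zero]; exact zero_mem _
    | add x y _ _ hx hy => rw [map_add]; exact add_mem hx hy
    | smul a x _ hx => rw [map_smul]; exact Subalgebra.smul_mem _ hx a
  have hx : x ∈ Subalgebra.toSubmodule
      (Algebra.adjoin k (Set.range fun i => UniversalEnvelopingAlgebra.ι k (b i))) := by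
    rw [h]; trivial
  rw [Algebra.adjoin_eq_span] at hx
  refine Submodule.span_mono ?_ hx
  intro y hy
  induction hy using Submonoid.closure_induction with
  | mem y h =>
    obtain ⟨i, rfl⟩ := h
    exact ⟨[i], by simp⟩
  | one => exact ⟨[], rfl⟩
  | mul y z _ _ hy hz =>
    obtain ⟨l, rfl⟩ := hy
    obtain ⟨m, rfl⟩ := hz
    exact ⟨l ++ m, by simp⟩

/-- For a Lie algebra with trivial center, the images in the enveloping algebra of a basis have
symbol functionals. -/
theorem exists_isSymbol_of_center_eq_bot [CharZero k] (hL : LieAlgebra.center k L = ⊥)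
    {κ : Type*} [Fintype κ] (b : Module.Basis κ k L) (c : κ → k) (n : ℕ) :
    ∃ φ, IsSymbol (fun i => UniversalEnvelopingAlgebra.ι k (b i)) c n φ := by
  classical
  let r : L →ₗ⁅k⁆ Matrix κ κ k :=
    ((LinearMap.toMatrixAlgEquiv b).toAlgHom : Module.End k L →ₗ⁅k⁆ Matrix κ κ k).comp
      (LieAlgebra.ad k L)
  have had : Function.Injective (LieAlgebra.ad k L) := by
    rw [← LieHom.ker_eq_bot, LieAlgebra.ad_ker_eq_self_module_ker,
      LieAlgebra.self_module_ker_eq_center, hL]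
  have hr : Function.Injective r := (LinearMap.toMatrixAlgEquiv b).injective.comp had
  exact exists_isSymbol_of_injective k r hr b c n

theorem nontrivial_enveloping : Nontrivial (UniversalEnvelopingAlgebra k L) :=
  (UniversalEnvelopingAlgebra.lift k (0 : L →ₗ⁅k⁆ k)).toRingHom.domain_nontrivial

/-- The enveloping algebra of a nonzero Lie algebra with trivial center has a nonzero element
lying in the augmentation ideal. -/
theorem exists_enveloping_ne_zero_not_isUnit [CharZero k] [FiniteDimensional k L] [Nontrivial L]
    (hL : LieAlgebra.center k L = ⊥) :
    ∃ a : UniversalEnvelopingAlgebra k L, a ≠ 0 ∧ (∀ b, a * b ≠ 1) ∧ ∀ b, b * a ≠ 1 := by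
  let b := Module.finBasis k L
  have i : Fin (Module.finrank k L) := ⟨0, Module.finrank_pos⟩
  obtain ⟨φ, hφ⟩ := exists_isSymbol_of_center_eq_bot hL b 1 1
  have hε : UniversalEnvelopingAlgebra.lift k (0 : L →ₗ⁅k⁆ k)
      (UniversalEnvelopingAlgebra.ι k (b i)) = 0 := by simp
  refine ⟨UniversalEnvelopingAlgebra.ι k (b i), fun h => ?_, fun c h => ?_, fun c h => ?_⟩
  · have := hφ.2 [i] rfl
    rw [List.map_singleton, List.prod_singleton, h, map_zero] at this
    simp at this
  · simpa [hε] using congrArg (UniversalEnvelopingAlgebra.lift k (0 : L →ₗ⁅k⁆ k)) h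
  · simpa [hε] using congrArg (UniversalEnvelopingAlgebra.lift k (0 : L →ₗ⁅k⁆ k)) h

/-- A ring is isomorphic to its opposite as a right module over itself. -/
def opLinearEquivSelf (R : Type*) [Ring R] : R ≃ₗ[Rᵐᵒᵖ] Rᵐᵒᵖ where
  __ := opAddEquiv
  map_smul' _ _ := rfl

end Enveloping

theorem stmt19 (k : Type u) [Field k] [CharZero k]
    (𝔤 : Type u) [LieRing 𝔤] [LieAlgebra k 𝔤] [FiniteDimensional k 𝔤]
    [LieAlgebra.IsSemisimple k 𝔤] [Nontrivial 𝔤] :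
    (fddGE (UniversalEnvelopingAlgebra k 𝔤) 1 (UniversalEnvelopingAlgebra k 𝔤) ∧
      ¬ fddGE (UniversalEnvelopingAlgebra k 𝔤) 2 (UniversalEnvelopingAlgebra k 𝔤)) ∧
    (fddGE (UniversalEnvelopingAlgebra k 𝔤)ᵐᵒᵖ 1 (UniversalEnvelopingAlgebra k 𝔤) ∧
      ¬ fddGE (UniversalEnvelopingAlgebra k 𝔤)ᵐᵒᵖ 2 (UniversalEnvelopingAlgebra k 𝔤)) := by
  have hcenter := LieAlgebra.center_eq_bot k 𝔤
  let b := Module.finBasis k 𝔤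
  have hcomm := enveloping_comm_mem_wordFil b
  have hspan := enveloping_mem_span_words b
  have := noZeroDivisors_of_isSymbol hcomm hspan (exists_isSymbol_of_center_eq_bot hcenter b)
  have : Nontrivial (UniversalEnvelopingAlgebra k 𝔤) := nontrivial_enveloping
  have hore := leftOre_of_wordFil hcomm hspan
  obtain ⟨a, ha, har, hal⟩ := exists_enveloping_ne_zero_not_isUnit hcenter
  refine ⟨⟨?_, ?_⟩, ?_, ?_⟩
  · exact fddGE_one_of_ore _ (fun a b ha hb => (hore a b ha hb).1)
      (fun a b ha hb => (hore a b ha hb).2) _ (LinearEquiv.refl _ _)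
  · exact not_fddGE_two_of_not_isUnit _ ha har _ (LinearEquiv.refl _ _)
  · refine fddGE_one_of_ore _ (fun a b ha hb => ?_) (fun a b ha hb => ?_) _
      (opLinearEquivSelf _)
    · obtain ⟨c, d, h, h0⟩ := (hore a.unop b.unop (by simpa using ha) (by simpa using hb)).2
      exact ⟨op c, op d, unop_injective h, fun h' => h0 (congrArg unop h')⟩
    · obtain ⟨c, d, h, h0⟩ := (hore a.unop b.unop (by simpa using ha) (by simpa using hb)).1
      exact ⟨op c, op d, unop_injective h, fun h' => h0 (congrArg unop h')⟩
  · exact not_fddGE_two_of_not_isUnit _ (a := op a) (by simpa using ha)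
      (fun b h => hal b.unop (congrArg unop h)) _ (opLinearEquivSelf _)
end
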